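/- Let (X_i)_{i≥0} be a stationary Markov chain with invariant measure μ and transition kernel K. If f belongs to C(M,p,μ) for some M > 0 and some p > 2, then for any q with 2 ≤ q < p and every n ≥ 1, ‖Σ_{i=1}^n (f(X_i) − μ(f))‖_q ≤ √(2q) · ( n ‖f(X_0) − μ(f)‖_q^2 + 4M^2 (p/(p−q))^{2/q} Σ_{k=1}^{n−1} (n−k)(2α_1(k))^{2(p−q)/(pq)} )^{1/2}. -/

import Mathlib

open MeasureTheory ProbabilityTheory Filter Set
open scoped ENNReal NNReal Topology

noncomputable section

/-- The intermittent (Liverani–Saussol–Vaienti) map `T_γ` on `[0,1]`. -/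
def Tmap (γ : ℝ) (x : ℝ) : ℝ :=
  if x < 1/2 then x * (1 + 2 ^ γ * x ^ γ) else 2 * x - 1

/-- `K` is the Perron–Frobenius operator of `T_γ` with respect to `ν`:
`ν(f · g∘T_γ) = ν(K f · g)` for all bounded measurable `f, g`. -/
def IsPFOp (γ : ℝ) (ν : Measure ℝ) (K : (ℝ → ℝ) → ℝ → ℝ) : Prop :=
  ∀ f g : ℝ → ℝ, Measurable f → Measurable g → (∃ C, ∀ x, |f x| ≤ C) →
    (∃ C, ∀ x, |g x| ≤ C) →
    ∫ x, f x * g (Tmap γ x) ∂ν = ∫ x, (K f) x * g x ∂ν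

/-- Birkhoff sums `S_n(f) = ∑_{i=1}^n f ∘ T_γ^i`. -/
def Sn (γ : ℝ) (f : ℝ → ℝ) (n : ℕ) (x : ℝ) : ℝ :=
  ∑ i ∈ Finset.range n, f ((Tmap γ)^[i + 1] x)

/-- The class `H_{α,1}` of `α`-Hölder functions (with constant 1) on `[0,1]`. -/
def Hclass (α : ℝ) : Set (ℝ → ℝ) :=
  {f | ∀ x ∈ Set.Icc (0:ℝ) 1, ∀ y ∈ Set.Icc (0:ℝ) 1, |f x - f y| ≤ |x - y| ^ α}

/-- `f_t = 1_{(-∞, t]}`. -/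
def indic (t : ℝ) : ℝ → ℝ := Set.indicator (Set.Iic t) (fun _ => 1)

/-- Nested operator `K^{(n_1,…,n_k)}(f_1,…,f_k)
= K^{n_1}(f_1 · K^{n_2}(f_2 ⋯ K^{n_k}(f_k)⋯))`, encoded by a list of pairs. -/
def nestedK (K : (ℝ → ℝ) → ℝ → ℝ) : List (ℕ × (ℝ → ℝ)) → ℝ → ℝ
  | [] => fun _ => 1
  | (n, f) :: r => K^[n] (fun x => f x * nestedK K r x)

/-- The list `[(n, f_{t_1}), (n_2, f_{t_2}), …, (n_l, f_{t_l})]`. -/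
def tList (n : ℕ) {l : ℕ} (ns : Fin l → ℕ) (ts : Fin (l + 1) → ℝ) :
    List (ℕ × (ℝ → ℝ)) :=
  (n, indic (ts 0)) :: List.ofFn (fun i : Fin l => (ns i, indic (ts i.succ)))

/-- The coefficient `α_1(n)` for an operator `K` with invariant measure `ν`. -/
def alpha1 (K : (ℝ → ℝ) → ℝ → ℝ) (ν : Measure ℝ) (n : ℕ) : ℝ :=
  ⨆ t : ℝ, ∫ x, |K^[n] (indic t) x - ∫ y, indic t y ∂ν| ∂ν

/-- The dependence coefficient `α_k(n)`. -/
def alphaCoef (K : (ℝ → ℝ) → ℝ → ℝ) (ν : Measure ℝ) (k n : ℕ) : ℝ :=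
  max (alpha1 K ν n)
    (⨆ j : Fin (k - 1), ⨆ ns : {m : Fin (j.1 + 1) → ℕ // ∀ i, 1 ≤ m i},
      ⨆ ts : Fin (j.1 + 2) → ℝ,
        ∫ x, |nestedK K (tList n ns.1 ts) x - ∫ y, nestedK K (tList n ns.1 ts) y ∂ν| ∂ν)

/-- The dependence coefficient `β_1(n)`. -/
def beta1 (K : (ℝ → ℝ) → ℝ → ℝ) (ν : Measure ℝ) (n : ℕ) : ℝ :=
  ∫ x, (⨆ t : ℝ, |K^[n] (indic t) x - ∫ y, indic t y ∂ν|) ∂ν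

/-- The dependence coefficient `β_k(n)`. -/
def betaCoef (K : (ℝ → ℝ) → ℝ → ℝ) (ν : Measure ℝ) (k n : ℕ) : ℝ :=
  max (beta1 K ν n)
    (⨆ j : Fin (k - 1), ⨆ ns : {m : Fin (j.1 + 1) → ℕ // ∀ i, 1 ≤ m i},
      ∫ x, (⨆ ts : Fin (j.1 + 2) → ℝ,
        |nestedK K (tList n ns.1 ts) x - ∫ y, nestedK K (tList n ns.1 ts) y ∂ν|) ∂ν)

/-- The operator associated with a Markov transition kernel: `(Kg)(x) = ∫ g(y) K(x,dy)`. -/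
def Kop (K : Kernel ℝ ℝ) (g : ℝ → ℝ) : ℝ → ℝ := fun x => ∫ y, g y ∂(K x)

/-- The class `Mon(M,p,μ)` of monotonic functions on an open interval, vanishing
elsewhere, with tail condition `μ(|g|>t) ≤ M^p t^{-p}` (for `p < ∞`),
resp. `μ(|g|>M) = 0` (for `p = ∞`). -/
def Mon (M : ℝ) (p : ℝ≥0∞) (μ : Measure ℝ) (g : ℝ → ℝ) : Prop :=
  (∃ I : Set ℝ, IsOpen I ∧ I.OrdConnected ∧ (MonotoneOn g I ∨ AntitoneOn g I) ∧
      ∀ x ∉ I, g x = 0) ∧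
  (if p = ∞ then μ {x | M < |g x|} = 0
   else ∀ t : ℝ, 0 < t →
      μ {x | t < |g x|} ≤ ENNReal.ofReal (M ^ p.toReal * t ^ (-p.toReal)))

/-- The class `C(M,p,μ)`: the closure in `L¹(μ)` of convex-type combinations
`∑ a_i g_i`, `∑ |a_i| ≤ 1`, `g_i ∈ Mon(M,p,μ)`. -/
def ClassC (M : ℝ) (p : ℝ≥0∞) (μ : Measure ℝ) (f : ℝ → ℝ) : Prop :=
  Integrable f μ ∧ ∀ ε : ℝ, 0 < ε → ∃ (n : ℕ) (a : Fin n → ℝ) (g : Fin n → ℝ → ℝ),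
    (∑ i, |a i|) ≤ 1 ∧ (∀ i, Mon M p μ (g i)) ∧
    ∫ x, |f x - ∑ i, a i * g i x| ∂μ < ε

/-- The class `Lip_c` of functions `g` with `|g(x) − g(y)| ≤ c(|x−y|)`. -/
def LipC (c : ℝ → ℝ) : Set (ℝ → ℝ) := {g | ∀ x y : ℝ, |g x - g y| ≤ c |x - y|}

/-- The distance `d_c(P,Q) = sup_{g ∈ Lip_c} |P(g) − Q(g)|`. -/
def dC (c : ℝ → ℝ) (P Q : Measure ℝ) : ℝ :=
  ⨆ g : LipC c, |(∫ x, (g : ℝ → ℝ) x ∂P) - ∫ x, (g : ℝ → ℝ) x ∂Q|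


lemma rpow_integral_growth {q c A : ℝ} (hq : 2 ≤ q) (hc : 0 ≤ c) (hA : 0 ≤ A) {h : ℝ → ℝ}
    (hcont : Continuous h) (h0 : ∀ t, 0 ≤ h t)
    (hle : ∀ t ∈ Icc (0 : ℝ) 1, h t ≤ A + c * ∫ u in (0 : ℝ)..t, h u ^ (1 - 2 / q)) :
    (A + c * ∫ u in (0 : ℝ)..1, h u ^ (1 - 2 / q)) ^ (2 / q) ≤ A ^ (2 / q) + 2 / q * c := by
  have hq0 : 0 < q := by linarith
  have h2q : 0 < 2 / q := by positivity
  have hθ : 0 ≤ 1 - 2 / q := by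
    have : 2 / q ≤ 1 := by rw [div_le_one hq0]; exact hq
    linarith
  have hk : Continuous fun u => h u ^ (1 - 2 / q) :=
    hcont.rpow_const fun u => Or.inr hθ
  set I : ℝ → ℝ := fun t => ∫ u in (0 : ℝ)..t, h u ^ (1 - 2 / q) with hI
  have hId : ∀ t, HasDerivAt I (h t ^ (1 - 2 / q)) t := fun t =>
    intervalIntegral.integral_hasDerivAt_right (hk.intervalIntegrable _ _)
      (hk.stronglyMeasurableAtFilter _ _) hk.continuousAt
  have hI0 : ∀ t, 0 ≤ t → 0 ≤ I t := fun t ht =>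
    intervalIntegral.integral_nonneg ht fun u _ => Real.rpow_nonneg (h0 u) _
  have key : ∀ ε : ℝ, 0 < ε →
      (A + ε + c * I 1) ^ (2 / q) ≤ (A + ε) ^ (2 / q) + 2 / q * c := by
    intro ε hε
    set G : ℝ → ℝ := fun t => A + ε + c * I t with hG
    have hGd : ∀ t, HasDerivAt G (c * h t ^ (1 - 2 / q)) t := fun t =>
      ((hId t).const_mul c).const_add (A + ε)
    have hGpos : ∀ t, 0 ≤ t → 0 < G t := fun t ht => by
      have := mul_nonneg hc (hI0 t ht)
      simp only [hG]; linarith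
    have hGc : Continuous G := continuous_iff_continuousAt.2 fun t => (hGd t).continuousAt
    have hPd : ∀ t, 0 ≤ t → HasDerivAt (fun t => G t ^ (2 / q))
        (c * h t ^ (1 - 2 / q) * (2 / q) * G t ^ (2 / q - 1)) t := fun t ht =>
      (hGd t).rpow_const (Or.inl (hGpos t ht).ne')
    have := (convex_Icc (0 : ℝ) 1).image_sub_le_mul_sub_of_deriv_le
      (f := fun t => G t ^ (2 / q)) (C := 2 / q * c)
      (hGc.rpow_const fun _ => Or.inr h2q.le).continuousOn
      (fun t ht => by
        rw [interior_Icc] at ht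
        exact (hPd t ht.1.le).differentiableAt.differentiableWithinAt)
      (fun t ht => by
        rw [interior_Icc] at ht
        rw [(hPd t ht.1.le).deriv]
        have hGt := hGpos t ht.1.le
        have h1 : h t ≤ G t := by
          have := hle t ⟨ht.1.le, ht.2.le⟩
          simp only [hG]; linarith
        have h2 : h t ^ (1 - 2 / q) ≤ G t ^ (1 - 2 / q) := Real.rpow_le_rpow (h0 t) h1 hθ
        have h3 : G t ^ (1 - 2 / q) * G t ^ (2 / q - 1) = 1 := by
          rw [← Real.rpow_add hGt]; simp
        have h4 : 0 ≤ G t ^ (2 / q - 1) := Real.rpow_nonneg hGt.le _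
        calc c * h t ^ (1 - 2 / q) * (2 / q) * G t ^ (2 / q - 1)
            = 2 / q * c * (h t ^ (1 - 2 / q) * G t ^ (2 / q - 1)) := by ring
          _ ≤ 2 / q * c * (G t ^ (1 - 2 / q) * G t ^ (2 / q - 1)) := by gcongr
          _ = 2 / q * c := by rw [h3, mul_one])
      0 (by simp) 1 (by simp) zero_le_one
    simp only [hG, hI, intervalIntegral.integral_same, mul_zero, add_zero, sub_zero,
      mul_one] at this
    simp only [hI]; linarith
  have hcon : ∀ B : ℝ, Tendsto (fun ε : ℝ => (A + ε + B) ^ (2 / q)) (𝓝[>] 0)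
      (𝓝 ((A + B) ^ (2 / q))) := fun B => by
    have : Continuous fun ε : ℝ => (A + ε + B) ^ (2 / q) :=
      (by fun_prop : Continuous fun ε : ℝ => A + ε + B).rpow_const fun _ => Or.inr h2q.le
    have h := this.tendsto 0
    simp only [add_zero] at h
    exact h.mono_left nhdsWithin_le_nhds
  refine le_of_tendsto_of_tendsto (hcon (c * I 1))
    ((by simpa using hcon 0 : Tendsto (fun ε : ℝ => (A + ε) ^ (2 / q)) (𝓝[>] 0)
      (𝓝 (A ^ (2 / q)))).add_const (2 / q * c)) ?_
  filter_upwards [self_mem_nhdsWithin] with ε hε using key ε hε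

/-- The function `x ↦ |x|^(q-2) x`, which is `1/q` times the derivative of `|x|^q`. -/
def signedPow (q x : ℝ) : ℝ := |x| ^ (q - 2) * x

lemma continuous_abs_rpow {r : ℝ} (hr : 0 ≤ r) : Continuous fun x : ℝ => |x| ^ r :=
  continuous_abs.rpow_const fun _ => Or.inr hr

lemma continuous_signedPow {q : ℝ} (hq : 2 ≤ q) : Continuous (signedPow q) :=
  (continuous_abs_rpow (by linarith)).mul continuous_id

lemma abs_signedPow {q : ℝ} (hq : 2 ≤ q) (x : ℝ) : |signedPow q x| = |x| ^ (q - 1) := by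
  rw [signedPow, abs_mul, abs_of_nonneg (Real.rpow_nonneg (abs_nonneg x) _)]
  conv_lhs => rw [← Real.rpow_one |x|, ← Real.rpow_mul (abs_nonneg x), one_mul]
  rw [← Real.rpow_add_of_nonneg (abs_nonneg x) (by linarith) zero_le_one]
  congr 1; ring

lemma hasDerivAt_signedPow {q : ℝ} (hq : 2 ≤ q) (x : ℝ) :
    HasDerivAt (signedPow q) ((q - 1) * |x| ^ (q - 2)) x := by
  rcases lt_trichotomy x 0 with hx | rfl | hx
  · have h1 : HasDerivAt (fun y : ℝ => -(-y) ^ (q - 1)) ((q - 1) * |x| ^ (q - 2)) x := by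
      have := ((hasDerivAt_neg x).rpow_const (p := q - 1) (Or.inl (by linarith))).neg
      refine this.congr_deriv ?_
      rw [abs_of_neg hx, show q - 1 - 1 = q - 2 by ring]; ring
    refine h1.congr_of_eventuallyEq ?_
    filter_upwards [Iio_mem_nhds hx] with y hy
    have hy : y < 0 := hy
    rw [signedPow, abs_of_neg hy, show q - 1 = q - 2 + 1 by ring,
      Real.rpow_add (by linarith), Real.rpow_one]; ring
  · rw [hasDerivAt_iff_tendsto_slope]
    have h1 : Tendsto (fun y : ℝ => |y| ^ (q - 2)) (𝓝[≠] 0) (𝓝 (|0| ^ (q - 2))) :=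
      ((continuous_abs_rpow (by linarith)).tendsto 0).mono_left nhdsWithin_le_nhds
    have h2 : (q - 1) * |(0 : ℝ)| ^ (q - 2) = |(0 : ℝ)| ^ (q - 2) := by
      rcases eq_or_lt_of_le hq with rfl | h
      · norm_num
      · rw [abs_zero, Real.zero_rpow (by linarith), mul_zero]
    rw [h2]
    refine h1.congr' ?_
    filter_upwards [self_mem_nhdsWithin] with y hy
    have hy : y ≠ 0 := hy
    simp [slope_def_field, signedPow, hy]
  · have h1 : HasDerivAt (fun y : ℝ => y ^ (q - 1)) ((q - 1) * |x| ^ (q - 2)) x := by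
      have := Real.hasDerivAt_rpow_const (x := x) (p := q - 1) (Or.inl hx.ne')
      convert this using 1
      rw [abs_of_pos hx, show q - 1 - 1 = q - 2 by ring]
    refine h1.congr_of_eventuallyEq ?_
    filter_upwards [Ioi_mem_nhds hx] with y hy
    have hy : 0 < y := hy
    rw [signedPow, abs_of_pos hy, show q - 1 = q - 2 + 1 by ring, Real.rpow_add hy,
      Real.rpow_one]

lemma signedPow_add_sub {q : ℝ} (hq : 2 ≤ q) (x y t : ℝ) :
    signedPow q (x + t * y) - signedPow q x
      = (q - 1) * y * ∫ u in (0 : ℝ)..t, |x + u * y| ^ (q - 2) := by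
  have hc : Continuous fun u : ℝ => (q - 1) * |x + u * y| ^ (q - 2) * y :=
    ((continuous_const.mul ((continuous_abs_rpow (by linarith)).comp (by fun_prop))).mul
      continuous_const)
  have h := intervalIntegral.integral_eq_sub_of_hasDerivAt (a := 0) (b := t)
    (f := fun u => signedPow q (x + u * y)) (f' := fun u => (q - 1) * |x + u * y| ^ (q - 2) * y)
    (fun u _ => by
      have h1 : HasDerivAt (fun u : ℝ => x + u * y) y u := by
        simpa using ((hasDerivAt_id u).mul_const y).const_add x
      exact (hasDerivAt_signedPow hq (x + u * y)).comp u h1)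
    (hc.intervalIntegrable _ _)
  simp only [zero_mul, add_zero] at h
  rw [← h, ← intervalIntegral.integral_const_mul]
  congr 1; ext u; ring

lemma abs_rpow_sub_le {q : ℝ} (hq : 2 ≤ q) (x z : ℝ) :
    |z| ^ q - |x| ^ q ≤ q * signedPow q z * (z - x) := by
  have hq1 : 1 < q := by linarith
  have hconj : (q / (q - 1)).HolderConjugate q :=
    (Real.HolderConjugate.conjExponent hq1).symm
  have h1 := Real.young_inequality_of_nonneg (Real.rpow_nonneg (abs_nonneg z) (q - 1))
    (abs_nonneg x) hconj
  rw [← Real.rpow_mul (abs_nonneg z), mul_div_cancel₀ _ (by linarith : q - 1 ≠ 0)] at h1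
  have h2 : signedPow q z * x ≤ |z| ^ (q - 1) * |x| := by
    rw [← abs_signedPow hq, ← abs_mul]; exact le_abs_self _
  have h3 : signedPow q z * z = |z| ^ q := by
    rw [signedPow, mul_assoc, ← abs_mul_abs_self z, ← sq, ← Real.rpow_two,
      ← Real.rpow_add_of_nonneg (abs_nonneg z) (by linarith) (by norm_num)]
    congr 1; ring
  have h4 : q * (|z| ^ q / (q / (q - 1)) + |x| ^ q / q) = (q - 1) * |z| ^ q + |x| ^ q := by
    have : q - 1 ≠ 0 := by linarith
    field_simp
  have h5 : q * (signedPow q z * x) ≤ (q - 1) * |z| ^ q + |x| ^ q := by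
    rw [← h4]; gcongr; exact h2.trans h1
  have h6 : q * signedPow q z * (z - x) = q * (signedPow q z * z) - q * (signedPow q z * x) := by
    ring
  rw [h6, h3]; linarith

lemma abs_add_rpow_le {q : ℝ} (hq : 2 ≤ q) (x y : ℝ) {t : ℝ} (ht0 : 0 ≤ t) (ht1 : t ≤ 1) :
    |x + t * y| ^ q ≤ |x| ^ q + t * (q * signedPow q x * y)
      + q * (q - 1) * (y ^ 2 * ∫ u in (0 : ℝ)..t, |x + u * y| ^ (q - 2)) := by
  have h1 := abs_rpow_sub_le hq x (x + t * y)
  have h2 := signedPow_add_sub hq x y t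
  have h3 : 0 ≤ ∫ u in (0 : ℝ)..t, |x + u * y| ^ (q - 2) :=
    intervalIntegral.integral_nonneg ht0 fun u _ => Real.rpow_nonneg (abs_nonneg _) _
  set J := ∫ u in (0 : ℝ)..t, |x + u * y| ^ (q - 2)
  have h4 : signedPow q (x + t * y) = signedPow q x + (q - 1) * y * J := by linarith
  rw [h4] at h1
  have h5 : 0 ≤ (1 - t) * (q * (q - 1) * (y ^ 2 * J)) := by
    have : 0 ≤ q - 1 := by linarith
    have : 0 ≤ 1 - t := by linarith
    positivity
  nlinarith

lemma rpow_le_of_recursion {q : ℝ} (hq : 2 ≤ q) {h : ℕ → ℝ → ℝ} (hcont : ∀ n, Continuous (h n))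
    (h0 : ∀ n t, 0 ≤ h n t) {a : ℕ → ℝ} (ha : ∀ i, 0 ≤ a i) (hzero : h 0 0 = 0)
    (hsucc : ∀ n, h (n + 1) 0 = h n 1)
    (hrec : ∀ n, ∀ t ∈ Icc (0 : ℝ) 1, h n t ≤ h n 0 + q * (q - 1) *
      (∑ j ∈ Finset.range n, a (n - j) * (∫ u in (0 : ℝ)..1, h j u ^ (1 - 2 / q))
        + a 0 * ∫ u in (0 : ℝ)..t, h n u ^ (1 - 2 / q))) (N : ℕ) :
    h N 0 ^ (2 / q) ≤ 2 * (q - 1) * ∑ n ∈ Finset.range N, ∑ i ∈ Finset.range (N - n), a i := by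
  have hq0 : 0 < q := by linarith
  have hc : 0 ≤ q * (q - 1) := mul_nonneg hq0.le (by linarith)
  set c := q * (q - 1) with hcdef
  set I : ℕ → ℝ → ℝ := fun j t => ∫ u in (0 : ℝ)..t, h j u ^ (1 - 2 / q) with hI
  have hI0 : ∀ j t, 0 ≤ t → 0 ≤ I j t := fun j t ht =>
    intervalIntegral.integral_nonneg ht fun u _ => Real.rpow_nonneg (h0 j u) _
  have hsum0 : ∀ m, 0 ≤ ∑ i ∈ Finset.range m, a i := fun m => Finset.sum_nonneg fun i _ => ha i
  have combine : ∀ n, (∑ j ∈ Finset.range n, (∑ i ∈ Finset.range (n - j), a i) * I j 1)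
      + ∑ j ∈ Finset.range n, a (n - j) * I j 1
      = ∑ j ∈ Finset.range n, (∑ i ∈ Finset.range (n + 1 - j), a i) * I j 1 := by
    intro n
    rw [← Finset.sum_add_distrib]
    refine Finset.sum_congr rfl fun j hj => ?_
    have hj := Finset.mem_range.1 hj
    rw [show n + 1 - j = (n - j) + 1 by omega, Finset.sum_range_succ, add_mul]
  have unroll : ∀ n, h n 0 ≤ c * ∑ j ∈ Finset.range n,
      (∑ i ∈ Finset.range (n - j), a i) * I j 1 := by
    intro n
    induction n with
    | zero => simp [hzero]
    | succ n ih =>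
      have h1 := hrec n 1 (by simp)
      rw [hsucc, Finset.sum_range_succ, ← combine]
      have h2 : (∑ i ∈ Finset.range (n + 1 - n), a i) = a 0 := by simp
      rw [h2]
      simp only [hI] at ih ⊢
      linarith
  set b : ℕ → ℝ := fun j => ∑ i ∈ Finset.range (N - j), a i with hb
  set A : ℕ → ℝ := fun n => c * ∑ j ∈ Finset.range n, b j * I j 1 with hA
  have hA0 : ∀ n, 0 ≤ A n := fun n => mul_nonneg hc
    (Finset.sum_nonneg fun j _ => mul_nonneg (hsum0 _) (hI0 j 1 zero_le_one))
  have bound : ∀ n < N, ∀ t ∈ Icc (0 : ℝ) 1, h n t ≤ A n + c * b n * I n t := by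
    intro n hn t ht
    have h1 := hrec n t ht
    have h2 := unroll n
    have h3 : ∑ j ∈ Finset.range n, (∑ i ∈ Finset.range (n + 1 - j), a i) * I j 1
        ≤ ∑ j ∈ Finset.range n, b j * I j 1 := by
      refine Finset.sum_le_sum fun j _ => mul_le_mul_of_nonneg_right ?_ (hI0 j 1 zero_le_one)
      exact Finset.sum_le_sum_of_subset_of_nonneg
        (Finset.range_mono (by omega)) fun i _ _ => ha i
    have h4 : a 0 * I n t ≤ b n * I n t := by
      refine mul_le_mul_of_nonneg_right ?_ (hI0 n t ht.1)
      exact Finset.single_le_sum (fun i _ => ha i) (Finset.mem_range.2 (by omega))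
    have h5 := combine n
    calc h n t ≤ c * (∑ j ∈ Finset.range n, (∑ i ∈ Finset.range (n - j), a i) * I j 1)
          + c * (∑ j ∈ Finset.range n, a (n - j) * I j 1 + a 0 * I n t) := by
          simp only [hI] at h2 ⊢; linarith
      _ = c * (∑ j ∈ Finset.range n, (∑ i ∈ Finset.range (n + 1 - j), a i) * I j 1
            + a 0 * I n t) := by rw [← h5]; ring
      _ ≤ c * (∑ j ∈ Finset.range n, b j * I j 1 + b n * I n t) := by gcongr
      _ = A n + c * b n * I n t := by simp only [hA]; ring
  have growth : ∀ n ≤ N, A n ^ (2 / q) ≤ 2 * (q - 1) * ∑ j ∈ Finset.range n, b j := by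
    intro n
    induction n with
    | zero =>
      intro _
      have : (2 / q) ≠ 0 := by positivity
      simp [hA, Real.zero_rpow this]
    | succ n ih =>
      intro hn
      have h1 := rpow_integral_growth hq (mul_nonneg hc (hsum0 (N - n))) (hA0 n) (hcont n)
        (h0 n) (bound n (by omega))
      have h2 : A (n + 1) = A n + c * b n * I n 1 := by
        simp only [hA]; rw [Finset.sum_range_succ]; ring
      rw [h2, Finset.sum_range_succ, mul_add]
      refine h1.trans (add_le_add (ih (by omega)) (le_of_eq ?_))
      simp only [hcdef, hb]; field_simp
  refine le_trans (Real.rpow_le_rpow (h0 N 0) ?_ (by positivity)) (growth N le_rfl)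
  exact unroll N

lemma memLp_ofReal_iff {Ω : Type*} [MeasurableSpace Ω] {P : Measure Ω} {q : ℝ} (hq : 0 < q)
    {f : Ω → ℝ} (hf : AEStronglyMeasurable f P) :
    MemLp f (ENNReal.ofReal q) P ↔ Integrable (fun ω => |f ω| ^ q) P := by
  rw [← integrable_norm_rpow_iff hf (by simpa using hq) ENNReal.ofReal_ne_top,
    ENNReal.toReal_ofReal hq.le]
  rfl

lemma mul_rpow_sub_two_le {q x y : ℝ} (hq : 2 ≤ q) (hx : 0 ≤ x) (hy : 0 ≤ y) :
    x * y ^ (q - 2) ≤ x ^ (q / 2) + y ^ q := by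
  have e1 : x * x ^ (q / 2 - 1) = x ^ (q / 2) := by
    conv_lhs => rw [← Real.rpow_one x, ← Real.rpow_mul hx, one_mul]
    rw [← Real.rpow_add_of_nonneg hx zero_le_one (by linarith)]
    congr 1; ring
  have e2 : y ^ 2 * y ^ (q - 2) = y ^ q := by
    rw [← Real.rpow_two, ← Real.rpow_add_of_nonneg hy (by norm_num) (by linarith)]
    congr 1; ring
  have h1 := Real.rpow_nonneg hx (q / 2)
  have h2 := Real.rpow_nonneg hy q
  rcases le_total x (y ^ 2) with h | h
  · have := mul_le_mul_of_nonneg_right h (Real.rpow_nonneg hy (q - 2))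
    linarith
  · have h3 : y ^ (q - 2) ≤ x ^ (q / 2 - 1) := by
      calc y ^ (q - 2) = (y ^ 2) ^ (q / 2 - 1) := by
            rw [← Real.rpow_two, ← Real.rpow_mul hy]; congr 1; ring
        _ ≤ x ^ (q / 2 - 1) := Real.rpow_le_rpow (by positivity) h (by linarith)
    have := mul_le_mul_of_nonneg_left h3 hx
    linarith

lemma rpow_sub_one_mul_le {q x y : ℝ} (hq : 2 ≤ q) (hx : 0 ≤ x) (hy : 0 ≤ y) :
    x ^ (q - 1) * y ≤ x ^ q + y ^ q := by
  have e : ∀ z : ℝ, 0 ≤ z → z ^ (q - 1) * z = z ^ q := fun z hz => by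
    conv_lhs => rw [← Real.rpow_one z, ← Real.rpow_mul hz, one_mul]
    rw [← Real.rpow_add_of_nonneg hz (by linarith) zero_le_one]
    congr 1; ring
  have h1 := Real.rpow_nonneg hx q
  have h2 := Real.rpow_nonneg hy q
  rcases le_total x y with h | h
  · have h3 : x ^ (q - 1) ≤ y ^ (q - 1) := Real.rpow_le_rpow hx h (by linarith)
    have := mul_le_mul_of_nonneg_right h3 hy
    rw [e y hy] at this; linarith
  · have := mul_le_mul_of_nonneg_left h (Real.rpow_nonneg hx (q - 1))
    rw [e x hx] at this; linarith

section MomentInequality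

variable {Ω : Type*} [MeasurableSpace Ω] {P : Measure Ω} {q : ℝ}

lemma integrable_mul_abs_rpow (hq : 2 ≤ q) {G U : Ω → ℝ} (hGm : Measurable G)
    (hUm : Measurable U) (hG : MemLp G (ENNReal.ofReal (q / 2)) P)
    (hU : MemLp U (ENNReal.ofReal q) P) :
    Integrable (fun ω => |G ω| * |U ω| ^ (q - 2)) P := by
  have h1 := (memLp_ofReal_iff (by linarith) hGm.aestronglyMeasurable).1 hG
  have h2 := (memLp_ofReal_iff (by linarith) hUm.aestronglyMeasurable).1 hU
  refine (h1.add h2).mono' (by fun_prop) (ae_of_all _ fun ω => ?_)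
  have h3 : 0 ≤ |G ω| * |U ω| ^ (q - 2) :=
    mul_nonneg (abs_nonneg _) (Real.rpow_nonneg (abs_nonneg _) _)
  rw [Real.norm_of_nonneg h3]
  exact mul_rpow_sub_two_le hq (abs_nonneg _) (abs_nonneg _)

lemma integral_mul_abs_rpow_le [IsProbabilityMeasure P] (hq : 2 ≤ q) {G U : Ω → ℝ}
    (hG : MemLp G (ENNReal.ofReal (q / 2)) P)
    (hU : MemLp U (ENNReal.ofReal q) P) :
    ∫ ω, |G ω| * |U ω| ^ (q - 2) ∂P
      ≤ (∫ ω, |G ω| ^ (q / 2) ∂P) ^ (2 / q) * (∫ ω, |U ω| ^ q ∂P) ^ (1 - 2 / q) := by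
  rcases eq_or_lt_of_le hq with rfl | hq2
  · simp
  have hq0 : 0 < q := by linarith
  have hconj : (q / 2).HolderConjugate (q / (q - 2)) := by
    rw [Real.holderConjugate_iff]
    refine ⟨by linarith, ?_⟩
    field_simp; ring
  have hU' : MemLp (fun ω => |U ω| ^ (q - 2)) (ENNReal.ofReal (q / (q - 2))) P := by
    have := hU.norm_rpow_div (ENNReal.ofReal (q - 2))
    rw [ENNReal.toReal_ofReal (by linarith), ← ENNReal.ofReal_div_of_pos (by linarith)] at this
    exact this
  have := integral_mul_le_Lp_mul_Lq_of_nonneg hconj (μ := P) (f := fun ω => |G ω|)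
    (g := fun ω => |U ω| ^ (q - 2)) (ae_of_all _ fun ω => abs_nonneg _)
    (ae_of_all _ fun ω => Real.rpow_nonneg (abs_nonneg _) _) hG.norm hU'
  refine this.trans (le_of_eq ?_)
  congr 2
  · field_simp
  · congr 1; ext ω
    rw [← Real.rpow_mul (abs_nonneg _), mul_div_cancel₀ _ (by linarith : q - 2 ≠ 0)]
  · field_simp

lemma continuous_integral_abs_add_rpow (hq : 2 ≤ q) {S Y : Ω → ℝ}
    (hS : MemLp S (ENNReal.ofReal q) P) (hY : MemLp Y (ENNReal.ofReal q) P) :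
    Continuous fun t : ℝ => ∫ ω, |S ω + t * Y ω| ^ q ∂P := by
  have hint : ∀ t : ℝ, Integrable (fun ω => |S ω + t * Y ω| ^ q) P := fun t =>
    (memLp_ofReal_iff (by linarith) (hS.add (hY.const_mul t)).1).1 (hS.add (hY.const_mul t))
  have hconv : ConvexOn ℝ univ fun t : ℝ => ∫ ω, |S ω + t * Y ω| ^ q ∂P := by
    refine ⟨convex_univ, fun s _ t _ a b ha hb hab => ?_⟩
    simp only [smul_eq_mul]
    rw [← integral_const_mul, ← integral_const_mul,
      ← integral_add ((hint s).const_mul a) ((hint t).const_mul b)]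
    refine integral_mono (hint _) (((hint s).const_mul a).add ((hint t).const_mul b)) fun ω => ?_
    have h1 : |S ω + (a * s + b * t) * Y ω| ≤ a * |S ω + s * Y ω| + b * |S ω + t * Y ω| := by
      have : S ω + (a * s + b * t) * Y ω = a * (S ω + s * Y ω) + b * (S ω + t * Y ω) := by
        linear_combination (-S ω) * hab
      rw [this]
      refine (abs_add_le _ _).trans (le_of_eq ?_)
      rw [abs_mul, abs_mul, abs_of_nonneg ha, abs_of_nonneg hb]
    have h2 := (convexOn_rpow (p := q) (by linarith)).2
      (show |S ω + s * Y ω| ∈ Ici (0 : ℝ) from abs_nonneg (S ω + s * Y ω))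
      (show |S ω + t * Y ω| ∈ Ici (0 : ℝ) from abs_nonneg (S ω + t * Y ω)) ha hb hab
    exact (Real.rpow_le_rpow (abs_nonneg _) h1 (by linarith)).trans h2
  exact continuousOn_univ.1 (hconv.continuousOn isOpen_univ)

lemma integrable_mul_integral_abs_rpow [IsProbabilityMeasure P] (hq : 2 ≤ q) {G S Y : Ω → ℝ}
    (hGm : Measurable G) (hSm : Measurable S) (hYm : Measurable Y)
    (hG : MemLp G (ENNReal.ofReal (q / 2)) P)
    (hS : MemLp S (ENNReal.ofReal q) P) (hY : MemLp Y (ENNReal.ofReal q) P)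
    {t : ℝ} (ht : t ∈ Icc (0 : ℝ) 1) :
    Integrable (Function.uncurry fun (u : ℝ) ω => |G ω| * |S ω + u * Y ω| ^ (q - 2))
      ((volume.restrict (uIoc 0 t)).prod P) := by
  have hT : MemLp (fun ω => |S ω| + |Y ω|) (ENNReal.ofReal q) P := hS.norm.add hY.norm
  have hTm : Measurable fun ω => |S ω| + |Y ω| := by fun_prop
  have : IsFiniteMeasure (volume.restrict (uIoc (0 : ℝ) t)) :=
    isFiniteMeasure_restrict.2 (by rw [uIoc_of_le ht.1]; simp)
  have h1 := (integrable_mul_abs_rpow hq hGm hTm hG hT).comp_snd (volume.restrict (uIoc 0 t))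
  refine h1.mono' ?_ ?_
  · refine Measurable.aestronglyMeasurable ?_
    simp only [Function.uncurry_def]
    fun_prop
  · have hae : ∀ᵐ u ∂(volume.restrict (uIoc 0 t)), u ∈ uIoc 0 t :=
      ae_restrict_mem measurableSet_uIoc
    have hae' : ∀ᵐ z ∂((volume.restrict (uIoc 0 t)).prod P), z.1 ∈ uIoc 0 t :=
      Measure.quasiMeasurePreserving_fst.ae hae
    filter_upwards [hae'] with z hz
    rw [uIoc_of_le ht.1] at hz
    have h3 : 0 ≤ |G z.2| * |S z.2 + z.1 * Y z.2| ^ (q - 2) :=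
      mul_nonneg (abs_nonneg _) (Real.rpow_nonneg (abs_nonneg _) _)
    simp only [Function.uncurry_def]
    rw [Real.norm_of_nonneg h3]
    refine mul_le_mul_of_nonneg_left (Real.rpow_le_rpow (abs_nonneg _) ?_ (by linarith))
      (abs_nonneg _)
    have h4 : |S z.2 + z.1 * Y z.2| ≤ |S z.2| + |Y z.2| := by
      refine (abs_add_le _ _).trans ?_
      rw [abs_mul, abs_of_pos hz.1]
      have := mul_le_mul_of_nonneg_right (hz.2.trans ht.2) (abs_nonneg (Y z.2))
      linarith
    exact h4.trans (le_abs_self _)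

lemma integral_mul_integral_abs_rpow_le [IsProbabilityMeasure P] (hq : 2 ≤ q) {G S Y : Ω → ℝ}
    (hGm : Measurable G) (hSm : Measurable S) (hYm : Measurable Y)
    (hG : MemLp G (ENNReal.ofReal (q / 2)) P)
    (hS : MemLp S (ENNReal.ofReal q) P) (hY : MemLp Y (ENNReal.ofReal q) P)
    {t : ℝ} (ht : t ∈ Icc (0 : ℝ) 1) {a : ℝ} (ha : (∫ ω, |G ω| ^ (q / 2) ∂P) ^ (2 / q) ≤ a) :
    Integrable (fun ω => |G ω| * ∫ u in (0 : ℝ)..t, |S ω + u * Y ω| ^ (q - 2)) P ∧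
    ∫ ω, |G ω| * (∫ u in (0 : ℝ)..t, |S ω + u * Y ω| ^ (q - 2)) ∂P
      ≤ a * ∫ u in (0 : ℝ)..t, (∫ ω, |S ω + u * Y ω| ^ q ∂P) ^ (1 - 2 / q) := by
  have hq0 : 0 < q := by linarith
  have hθ : 0 ≤ 1 - 2 / q := by
    have : 2 / q ≤ 1 := by rw [div_le_one hq0]; exact hq
    linarith
  have hint := integrable_mul_integral_abs_rpow hq hGm hSm hYm hG hS hY ht
  simp only [← intervalIntegral.integral_const_mul]
  refine ⟨?_, ?_⟩
  · have := hint.integral_prod_right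
    simpa only [intervalIntegral.integral_of_le ht.1, uIoc_of_le ht.1, Function.uncurry_def]
      using this
  · rw [← intervalIntegral_integral_swap hint]
    refine intervalIntegral.integral_mono_on ht.1 ?_ ?_ fun u _ => ?_
    · rw [intervalIntegrable_iff]
      exact hint.integral_prod_left
    · exact (continuous_const.mul ((continuous_integral_abs_add_rpow hq hS hY).rpow_const
        fun _ => Or.inr hθ)).intervalIntegrable _ _
    · refine (integral_mul_abs_rpow_le hq hG
        (hS.add (hY.const_mul u))).trans ?_
      exact mul_le_mul_of_nonneg_right ha (Real.rpow_nonneg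
        (integral_nonneg fun ω => Real.rpow_nonneg (abs_nonneg _) _) _)

lemma integrable_signedPow_mul (hq : 2 ≤ q) {S Y : Ω → ℝ} (hSm : Measurable S)
    (hS : MemLp S (ENNReal.ofReal q) P) (hYm : Measurable Y) (hY : MemLp Y (ENNReal.ofReal q) P) :
    Integrable (fun ω => signedPow q (S ω) * Y ω) P := by
  have hq0 : 0 < q := by linarith
  have h1 := (memLp_ofReal_iff hq0 hSm.aestronglyMeasurable).1 hS
  have h2 := (memLp_ofReal_iff hq0 hYm.aestronglyMeasurable).1 hY
  refine (h1.add h2).mono' (((continuous_signedPow hq).measurable.comp hSm).mul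
    hYm).aestronglyMeasurable (ae_of_all _ fun ω => ?_)
  rw [Real.norm_eq_abs, abs_mul, abs_signedPow hq]
  exact rpow_sub_one_mul_le hq (abs_nonneg _) (abs_nonneg _)

/-- A moment inequality of Rio type for partial sums, in which the covariances of the increments
of `signedPow q` along the partial sums are controlled by projections `G`. -/
lemma integral_abs_sum_rpow_le [IsProbabilityMeasure P] (hq : 2 ≤ q) {Y : ℕ → Ω → ℝ}
    (hYm : ∀ i, Measurable (Y i)) (hY : ∀ i, MemLp (Y i) (ENNReal.ofReal q) P)
    {a : ℕ → ℝ} (ha : ∀ i, 0 ≤ a i) (ha0 : ∀ n, (∫ ω, |Y n ω| ^ q ∂P) ^ (2 / q) ≤ a 0)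
    (hproj : ∀ n, ∀ j < n, ∃ G : Ω → ℝ, Measurable G ∧
      MemLp (fun ω => Y j ω * G ω) (ENNReal.ofReal (q / 2)) P ∧
      (∫ ω, |Y j ω * G ω| ^ (q / 2) ∂P) ^ (2 / q) ≤ a (n - j) ∧
      ∫ ω, (signedPow q (∑ i ∈ Finset.range (j + 1), Y i ω)
          - signedPow q (∑ i ∈ Finset.range j, Y i ω)) * Y n ω ∂P
        ≤ ∫ ω, |signedPow q (∑ i ∈ Finset.range (j + 1), Y i ω)
          - signedPow q (∑ i ∈ Finset.range j, Y i ω)| * |G ω| ∂P) (N : ℕ) :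
    (∫ ω, |∑ i ∈ Finset.range N, Y i ω| ^ q ∂P) ^ (2 / q)
      ≤ 2 * (q - 1) * ∑ n ∈ Finset.range N, ∑ i ∈ Finset.range (N - n), a i := by
  have hq0 : 0 < q := by linarith
  set S : ℕ → Ω → ℝ := fun n ω => ∑ i ∈ Finset.range n, Y i ω with hS
  have hSm : ∀ n, Measurable (S n) := fun n => Finset.measurable_sum _ fun i _ => hYm i
  have hSL : ∀ n, MemLp (S n) (ENNReal.ofReal q) P := fun n =>
    memLp_finsetSum _ fun i _ => hY i
  set h : ℕ → ℝ → ℝ := fun n t => ∫ ω, |S n ω + t * Y n ω| ^ q ∂P with hh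
  have hSsucc : ∀ n ω, S (n + 1) ω = S n ω + Y n ω := fun n ω => Finset.sum_range_succ _ _
  have hprodint : ∀ j n, Integrable (fun ω => signedPow q (S j ω) * Y n ω) P := fun j n =>
    integrable_signedPow_mul hq (hSm j) (hSL j) (hYm n) (hY n)
  have hcov : ∀ n, ∀ j < n,
      ∫ ω, (signedPow q (S (j + 1) ω) - signedPow q (S j ω)) * Y n ω ∂P
        ≤ (q - 1) * (a (n - j) * ∫ u in (0 : ℝ)..1, h j u ^ (1 - 2 / q)) := by
    intro n j hj
    obtain ⟨G, hGm, hGL, hGa, hGle⟩ := hproj n j hj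
    refine hGle.trans ?_
    have h1 := (integral_mul_integral_abs_rpow_le hq ((hYm j).mul hGm) (hSm j) (hYm j) hGL
      (hSL j) (hY j) (t := 1) (by simp) hGa).2
    refine le_trans (le_of_eq ?_) (mul_le_mul_of_nonneg_left h1 (by linarith : 0 ≤ q - 1))
    rw [← integral_const_mul]
    congr 1; ext ω
    have h2 := signedPow_add_sub hq (S j ω) (Y j ω) 1
    rw [one_mul, ← hSsucc] at h2
    have h3 : 0 ≤ ∫ u in (0 : ℝ)..1, |S j ω + u * Y j ω| ^ (q - 2) :=
      intervalIntegral.integral_nonneg zero_le_one fun u _ => Real.rpow_nonneg (abs_nonneg _) _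
    change |signedPow q (S (j + 1) ω) - signedPow q (S j ω)| * |G ω| = _
    rw [h2, abs_mul, abs_mul, abs_of_nonneg h3, abs_of_nonneg (by linarith : 0 ≤ q - 1),
      Pi.mul_apply, abs_mul]
    ring
  have hsum : ∀ n, ∫ ω, signedPow q (S n ω) * Y n ω ∂P ≤ (q - 1) *
      ∑ j ∈ Finset.range n, a (n - j) * ∫ u in (0 : ℝ)..1, h j u ^ (1 - 2 / q) := by
    intro n
    have h1 : ∀ ω, signedPow q (S n ω) * Y n ω = ∑ j ∈ Finset.range n,
        (signedPow q (S (j + 1) ω) - signedPow q (S j ω)) * Y n ω := fun ω => by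
      rw [← Finset.sum_mul, Finset.sum_range_sub fun j => signedPow q (S j ω)]
      simp [hS, signedPow]
    simp only [h1]
    rw [integral_finsetSum _ fun j _ => ((hprodint (j + 1) n).sub (hprodint j n)).congr
      (ae_of_all _ fun ω => by simp [sub_mul]), Finset.mul_sum]
    exact Finset.sum_le_sum fun j hj => hcov n j (Finset.mem_range.1 hj)
  have h0 : ∀ n t, 0 ≤ h n t := fun n t =>
    integral_nonneg fun ω => Real.rpow_nonneg (abs_nonneg _) _
  have hrec : ∀ n, ∀ t ∈ Icc (0 : ℝ) 1, h n t ≤ h n 0 + q * (q - 1) *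
      (∑ j ∈ Finset.range n, a (n - j) * (∫ u in (0 : ℝ)..1, h j u ^ (1 - 2 / q))
        + a 0 * ∫ u in (0 : ℝ)..t, h n u ^ (1 - 2 / q)) := by
    intro n t ht
    have hsq : MemLp (fun ω => Y n ω ^ 2) (ENNReal.ofReal (q / 2)) P := by
      rw [memLp_ofReal_iff (by linarith) ((hYm n).pow_const 2).aestronglyMeasurable]
      refine ((memLp_ofReal_iff hq0 (hYm n).aestronglyMeasurable).1 (hY n)).congr
        (ae_of_all _ fun ω => ?_)
      simp only
      rw [abs_pow, ← Real.rpow_two, ← Real.rpow_mul (abs_nonneg _)]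
      congr 1; ring
    have hsqa : (∫ ω, |Y n ω ^ 2| ^ (q / 2) ∂P) ^ (2 / q) ≤ a 0 := by
      refine le_trans (le_of_eq ?_) (ha0 n)
      congr 2; ext ω
      rw [abs_pow, ← Real.rpow_two, ← Real.rpow_mul (abs_nonneg _)]
      congr 1; ring
    obtain ⟨hi, hle⟩ := integral_mul_integral_abs_rpow_le hq ((hYm n).pow_const 2) (hSm n)
      (hYm n) hsq (hSL n) (hY n) ht hsqa
    have hiS := (memLp_ofReal_iff hq0 (hSm n).aestronglyMeasurable).1 (hSL n)
    have hiST := (memLp_ofReal_iff hq0 ((hSL n).add ((hY n).const_mul t)).1).1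
      ((hSL n).add ((hY n).const_mul t))
    have h1 : h n t ≤ (∫ ω, |S n ω| ^ q ∂P) + t * q * (∫ ω, signedPow q (S n ω) * Y n ω ∂P)
        + q * (q - 1) *
          ∫ ω, |Y n ω ^ 2| * (∫ u in (0 : ℝ)..t, |S n ω + u * Y n ω| ^ (q - 2)) ∂P := by
      have hi2 : Integrable (fun ω => |S n ω| ^ q + t * q * (signedPow q (S n ω) * Y n ω)) P :=
        hiS.add ((hprodint n n).const_mul _)
      rw [← integral_const_mul, ← integral_const_mul,
        ← integral_add hiS ((hprodint n n).const_mul _),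
        ← integral_add hi2 (hi.const_mul _)]
      refine integral_mono hiST (hi2.add (hi.const_mul _)) fun ω => ?_
      have := abs_add_rpow_le hq (S n ω) (Y n ω) ht.1 ht.2
      simp only [abs_of_nonneg (sq_nonneg (Y n ω))]
      linarith
    have h2 : h n 0 = ∫ ω, |S n ω| ^ q ∂P := by simp [hh]
    have h3 : 0 ≤ ∑ j ∈ Finset.range n, a (n - j) * ∫ u in (0 : ℝ)..1, h j u ^ (1 - 2 / q) :=
      Finset.sum_nonneg fun j _ => mul_nonneg (ha _)
        (intervalIntegral.integral_nonneg zero_le_one fun u _ => Real.rpow_nonneg (h0 j u) _)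
    have h4 := mul_le_mul_of_nonneg_left (hsum n) (mul_nonneg ht.1 hq0.le)
    have hqq : 0 ≤ q * (q - 1) := mul_nonneg hq0.le (by linarith)
    have h5 := mul_le_mul_of_nonneg_right ht.2 (mul_nonneg hqq h3)
    have h6 := mul_le_mul_of_nonneg_left hle hqq
    rw [h2]
    simp only [hh] at h1 h4 h5 h6 ⊢
    linarith
  have := rpow_le_of_recursion hq (fun n => continuous_integral_abs_add_rpow hq (hSL n) (hY n))
    h0 ha (by simp [hS, Real.zero_rpow hq0.ne'])
    (fun n => by simp only [zero_mul, add_zero, one_mul, hSsucc]) hrec N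
  simpa [hh] using this

end MomentInequality

section InvariantKernel

variable {μ : Measure ℝ} {κ : Kernel ℝ ℝ}

lemma snd_compProd_of_bind_eq [SFinite μ] [IsSFiniteKernel κ] (h : μ.bind κ = μ) :
    (μ ⊗ₘ κ).map Prod.snd = μ := by
  rw [← Measure.snd, Measure.snd_compProd, h]

lemma integrable_comp_snd_of_bind_eq [SFinite μ] [IsSFiniteKernel κ] (h : μ.bind κ = μ)
    {g : ℝ → ℝ} (hg : Integrable g μ) : Integrable (fun z : ℝ × ℝ => g z.2) (μ ⊗ₘ κ) := by
  rw [← snd_compProd_of_bind_eq h] at hg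
  exact hg.comp_measurable measurable_snd

lemma ae_integrable_of_bind_eq [SFinite μ] [IsSFiniteKernel κ] (h : μ.bind κ = μ)
    {g : ℝ → ℝ} (hg : Integrable g μ) : ∀ᵐ x ∂μ, Integrable g (κ x) := by
  have h1 := integrable_comp_snd_of_bind_eq h hg
  exact ((Measure.integrable_compProd_iff h1.1).1 h1).1

lemma integrable_integral_of_bind_eq [SFinite μ] [IsSFiniteKernel κ] (h : μ.bind κ = μ)
    {g : ℝ → ℝ} (hg : Integrable g μ) : Integrable (fun x => ∫ y, g y ∂κ x) μ := by
  have h1 : Integrable (fun z : ℝ × ℝ => g z.2)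
      ((Kernel.const Unit μ ⊗ₖ Kernel.prodMkLeft Unit κ) ()) :=
    integrable_comp_snd_of_bind_eq h hg
  simpa using h1.integral_compProd

lemma integral_integral_of_bind_eq [SFinite μ] [IsSFiniteKernel κ] (h : μ.bind κ = μ)
    {g : ℝ → ℝ} (hg : Integrable g μ) : ∫ x, ∫ y, g y ∂κ x ∂μ = ∫ x, g x ∂μ := by
  rw [← Measure.integral_compProd (f := fun z => g z.2) (integrable_comp_snd_of_bind_eq h hg)]
  conv_rhs => rw [← snd_compProd_of_bind_eq h]
  rw [integral_map measurable_snd.aemeasurable]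
  rw [snd_compProd_of_bind_eq h]
  exact hg.1

/-- Jensen's inequality for the half difference between a kernel average and the mean. -/
lemma integral_convex_half_sub_le [IsProbabilityMeasure μ] [IsMarkovKernel κ]
    (h : μ.bind κ = μ) {φ : ℝ → ℝ} (hφ : ConvexOn ℝ univ φ) (hφe : ∀ x, φ (-x) = φ x)
    (hφ0 : ∀ x, 0 ≤ φ x) {g : ℝ → ℝ} (hg : Integrable g μ)
    (hφg : Integrable (fun x => φ (g x)) μ) :
    Integrable (fun x => φ ((∫ y, g y ∂κ x - ∫ y, g y ∂μ) / 2)) μ ∧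
      ∫ x, φ ((∫ y, g y ∂κ x - ∫ y, g y ∂μ) / 2) ∂μ ≤ ∫ x, φ (g x) ∂μ := by
  have hφc : Continuous φ := by
    rw [← continuousOn_univ]; exact hφ.continuousOn isOpen_univ
  have hJ : ∀ ν : Measure ℝ, IsProbabilityMeasure ν → Integrable g ν →
      Integrable (fun x => φ (g x)) ν → φ (∫ y, g y ∂ν) ≤ ∫ y, φ (g y) ∂ν := fun ν _ h1 h2 =>
    hφ.map_integral_le hφc.continuousOn isClosed_univ (by simp) h1 h2
  have hpt : ∀ᵐ x ∂μ, φ ((∫ y, g y ∂κ x - ∫ y, g y ∂μ) / 2)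
      ≤ 1 / 2 * (∫ y, φ (g y) ∂κ x) + 1 / 2 * ∫ y, φ (g y) ∂μ := by
    filter_upwards [ae_integrable_of_bind_eq h hg, ae_integrable_of_bind_eq h hφg] with x h1 h2
    have h3 := hφ.2 (mem_univ (∫ y, g y ∂κ x)) (mem_univ (-∫ y, g y ∂μ))
      (by norm_num : (0 : ℝ) ≤ 1 / 2) (by norm_num : (0 : ℝ) ≤ 1 / 2) (by norm_num)
    rw [hφe] at h3
    simp only [smul_eq_mul] at h3
    have h4 := hJ _ inferInstance h1 h2
    have h5 := hJ μ inferInstance hg hφg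
    have h6 : (∫ y, g y ∂κ x - ∫ y, g y ∂μ) / 2
        = 1 / 2 * (∫ y, g y ∂κ x) + 1 / 2 * -∫ y, g y ∂μ := by ring
    rw [h6]; linarith
  have hi := ((integrable_integral_of_bind_eq h hφg).const_mul (1 / 2)).add
    (integrable_const (1 / 2 * ∫ y, φ (g y) ∂μ))
  have hI : Integrable (fun x => φ ((∫ y, g y ∂κ x - ∫ y, g y ∂μ) / 2)) μ := by
    refine hi.mono' (hφc.comp_aestronglyMeasurable
      (((integrable_integral_of_bind_eq h hg).sub (integrable_const _)).div_const 2).1) ?_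
    filter_upwards [hpt] with x hx
    rwa [Real.norm_eq_abs, abs_of_nonneg (hφ0 _)]
  refine ⟨hI, (integral_mono_ae hI hi hpt).trans (le_of_eq ?_)⟩
  rw [integral_add' ((integrable_integral_of_bind_eq h hφg).const_mul (1 / 2))
    (integrable_const _), integral_const_mul, integral_integral_of_bind_eq h hφg]
  simp; ring

end InvariantKernel

section ConvexFunctions

lemma convexOn_abs_rpow {q : ℝ} (hq : 1 ≤ q) : ConvexOn ℝ univ fun x : ℝ => |x| ^ q := by
  refine ⟨convex_univ, fun x _ y _ a b ha hb hab => ?_⟩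
  have h := (convexOn_rpow hq).2 (abs_nonneg x) (abs_nonneg y) ha hb hab
  refine le_trans (Real.rpow_le_rpow (abs_nonneg _) ?_ (by linarith)) h
  simp only [smul_eq_mul]
  exact (abs_add_le _ _).trans (by rw [abs_mul, abs_mul, abs_of_nonneg ha, abs_of_nonneg hb])

lemma convexOn_abs_rpow_sub_one {q : ℝ} (hq : 1 ≤ q) :
    ConvexOn ℝ univ fun x : ℝ => max (|x| ^ q - 1) 0 :=
  ((convexOn_abs_rpow hq).sub (concaveOn_const 1 convex_univ)).sup
    (convexOn_const 0 convex_univ)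

lemma convexOn_rpow_div_sub {q : ℝ} (hq : 1 ≤ q) :
    ConvexOn ℝ (Ici 1) fun x : ℝ => x ^ q / q - x := by
  refine ((((convexOn_rpow hq).subset (Ici_subset_Ici.2 zero_le_one) (convex_Ici 1)).smul
    (by positivity : (0 : ℝ) ≤ q⁻¹)).sub (concaveOn_id (convex_Ici 1))).congr fun x _ => ?_
  simp [div_eq_inv_mul]

lemma monotoneOn_rpow_div_sub {q : ℝ} (hq : 1 ≤ q) :
    MonotoneOn (fun x : ℝ => x ^ q / q - x) (Ici 1) := by
  have hd : ∀ x : ℝ, HasDerivAt (fun x : ℝ => x ^ q / q - x) (x ^ (q - 1) - 1) x := fun x => by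
    have := ((Real.hasDerivAt_rpow_const (x := x) (Or.inr hq)).div_const q).sub (hasDerivAt_id x)
    have hq0 : q ≠ 0 := by linarith
    rw [mul_div_cancel_left₀ _ hq0] at this
    exact this
  refine monotoneOn_of_deriv_nonneg (convex_Ici 1)
    (fun x _ => (hd x).continuousAt.continuousWithinAt)
    (fun x _ => (hd x).differentiableAt.differentiableWithinAt) fun x hx => ?_
  rw [interior_Ici] at hx
  rw [(hd x).deriv, sub_nonneg]
  exact Real.one_le_rpow (le_of_lt hx) (by linarith)

/-- The part of `(|x| ^ q - 1)⁺ / q` in excess of `(|x| - 1)⁺`. -/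
def rpowExcess (q x : ℝ) : ℝ := max (|x| ^ q - 1) 0 / q - max (|x| - 1) 0

lemma rpowExcess_eq {q : ℝ} (hq : 1 ≤ q) (x : ℝ) :
    rpowExcess q x = (max |x| 1) ^ q / q - max |x| 1 + (1 - 1 / q) := by
  unfold rpowExcess
  rcases le_total |x| 1 with h | h
  · have h2 := Real.rpow_le_one (abs_nonneg x) h (by linarith : 0 ≤ q)
    rw [max_eq_right h, max_eq_right (by linarith), max_eq_right (by linarith), Real.one_rpow]
    ring
  · have h2 := Real.one_le_rpow h (by linarith : 0 ≤ q)
    rw [max_eq_left h, max_eq_left (by linarith), max_eq_left (by linarith)]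
    ring

lemma convexOn_rpowExcess {q : ℝ} (hq : 1 ≤ q) : ConvexOn ℝ univ (rpowExcess q) := by
  refine ⟨convex_univ, fun x _ y _ a b ha hb hab => ?_⟩
  have h1 : max |a • x + b • y| 1 ≤ a • max |x| 1 + b • max |y| 1 := by
    simp only [smul_eq_mul]
    refine max_le ((abs_add_le _ _).trans ?_) ?_
    · rw [abs_mul, abs_mul, abs_of_nonneg ha, abs_of_nonneg hb]
      gcongr <;> exact le_max_left _ _
    · nlinarith [mul_le_mul_of_nonneg_left (le_max_right |x| 1) ha,
        mul_le_mul_of_nonneg_left (le_max_right |y| 1) hb]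
  have hx : max |x| 1 ∈ Ici (1 : ℝ) := mem_Ici.2 (le_max_right _ _)
  have hy : max |y| 1 ∈ Ici (1 : ℝ) := mem_Ici.2 (le_max_right _ _)
  have h2 := (convexOn_rpow_div_sub hq).2 hx hy ha hb hab
  have h3 := monotoneOn_rpow_div_sub hq (mem_Ici.2 (le_max_right |a • x + b • y| 1))
    ((convex_Ici (1 : ℝ)) hx hy ha hb hab) h1
  rw [rpowExcess_eq hq, rpowExcess_eq hq, rpowExcess_eq hq]
  have h4 := h3.trans h2
  simp only [smul_eq_mul] at h4 ⊢
  have h5 : a * (1 - 1 / q) + b * (1 - 1 / q) = 1 - 1 / q := by rw [← add_mul, hab, one_mul]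
  linarith

lemma rpowExcess_nonneg {q : ℝ} (hq : 1 ≤ q) (x : ℝ) : 0 ≤ rpowExcess q x := by
  have h := monotoneOn_rpow_div_sub hq (self_mem_Ici : (1 : ℝ) ∈ Ici 1)
    (mem_Ici.2 (le_max_right |x| 1)) (le_max_right |x| 1)
  rw [rpowExcess_eq hq]
  simp only [Real.one_rpow] at h
  linarith

lemma rpow_mul_rpow_le_min_add {r x y : ℝ} (hr : 1 ≤ r) (hx : 0 ≤ x) (hy : 0 ≤ y) :
    x ^ r * y ^ r ≤ min y 1 + max (x ^ (2 * r) - 1) 0 / 2 + max (y ^ (2 * r) - 1) 0 / 2 := by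
  have hx2 : x ^ (2 * r) = x ^ r * x ^ r := by
    rw [two_mul, Real.rpow_add_of_nonneg hx (by linarith) (by linarith)]
  have hy2 : y ^ (2 * r) = y ^ r * y ^ r := by
    rw [two_mul, Real.rpow_add_of_nonneg hy (by linarith) (by linarith)]
  rw [hx2, hy2]
  have hu := Real.rpow_nonneg hx r
  have hv := Real.rpow_nonneg hy r
  have m1 := le_max_left (x ^ r * x ^ r - 1) 0
  have m2 := le_max_right (x ^ r * x ^ r - 1) 0
  have m3 := le_max_left (y ^ r * y ^ r - 1) 0
  have m4 := le_max_right (y ^ r * y ^ r - 1) 0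
  rcases le_total y 1 with h | h
  · rw [min_eq_left h]
    have h1 : y ^ r ≤ y := by
      simpa using Real.rpow_le_rpow_of_exponent_ge' hy h zero_le_one hr
    rcases le_total (x ^ r) 1 with h2 | h2 <;> nlinarith
  · rw [min_eq_right h]
    nlinarith [sq_nonneg (x ^ r - y ^ r)]

end ConvexFunctions

section LevelSets

variable {μ : Measure ℝ} {κ : Kernel ℝ ℝ}

lemma measurable_kernel_real_lt [IsMarkovKernel κ] {h : ℝ → ℝ} (hm : Measurable h) :
    Measurable fun z : ℝ × ℝ => (κ z.1).real {y | z.2 < h y} := by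
  have h1 : MeasurableSet {z : (ℝ × ℝ) × ℝ | z.1.2 < h z.2} :=
    measurableSet_lt (measurable_snd.comp measurable_fst) (hm.comp measurable_snd)
  exact (Kernel.measurable_kernel_prodMk_left (κ := Kernel.prodMkRight ℝ κ) h1).ennreal_toReal

lemma abs_measureReal_sub_le_one {ν : Measure ℝ} [IsProbabilityMeasure μ]
    [IsProbabilityMeasure ν] (S : Set ℝ) : |ν.real S - μ.real S| ≤ 1 := by
  have h1 := measureReal_le_one (μ := μ) (s := S)
  have h2 := measureReal_le_one (μ := ν) (s := S)
  have h3 : 0 ≤ μ.real S := measureReal_nonneg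
  have h4 : 0 ≤ ν.real S := measureReal_nonneg
  exact abs_le.2 ⟨by linarith, by linarith⟩

lemma integrable_abs_kernel_real_sub [IsProbabilityMeasure μ] [IsMarkovKernel κ]
    {S : Set ℝ} (hS : MeasurableSet S) :
    Integrable (fun x => |(κ x).real S - μ.real S|) μ := by
  refine Integrable.of_bound (C := 1)
    (((κ.measurable_coe hS).ennreal_toReal.sub_const _).abs.aestronglyMeasurable)
    (ae_of_all _ fun x => ?_)
  rw [Real.norm_eq_abs, abs_abs]
  exact abs_measureReal_sub_le_one S

lemma integral_clamp_eq (ν : Measure ℝ) [IsProbabilityMeasure ν] {h : ℝ → ℝ}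
    (hm : Measurable h) :
    ∫ y, max (min (h y) 1) 0 ∂ν = ∫ t in Ioo (0 : ℝ) 1, ν.real {y | t < h y} := by
  have hi : Integrable (fun y => max (min (h y) 1) 0) ν := by
    refine Integrable.of_bound (C := 1)
      ((hm.min measurable_const).max measurable_const).aestronglyMeasurable
      (ae_of_all _ fun x => ?_)
    rw [Real.norm_eq_abs, abs_of_nonneg (le_max_right _ _)]
    exact max_le (min_le_right _ _) zero_le_one
  rw [hi.integral_eq_integral_meas_lt (ae_of_all _ fun x => le_max_right _ _)]
  have h1 : ∫ t in Ioi (0 : ℝ), ν.real {y | t < max (min (h y) 1) 0}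
      = ∫ t in Ioo (0 : ℝ) 1, ν.real {y | t < max (min (h y) 1) 0} := by
    refine setIntegral_eq_of_subset_of_forall_sdiff_eq_zero measurableSet_Ioi
      (fun x hx => hx.1) fun t ht => ?_
    have : {y | t < max (min (h y) 1) 0} = ∅ := by
      ext y
      simp only [mem_ofPred_eq, mem_empty_iff_false, iff_false, not_lt]
      have h2 : 1 ≤ t := by
        by_contra h3
        exact ht.2 ⟨ht.1, not_le.1 h3⟩
      exact max_le ((min_le_right _ _).trans h2) (zero_le_one.trans h2)
    rw [this]; simp
  rw [h1]
  refine setIntegral_congr_fun measurableSet_Ioo fun t ht => ?_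
  congr 1
  ext y
  simp [ht.2, not_lt.2 ht.1.le]

lemma integral_abs_clamp_sub_le [IsProbabilityMeasure μ] [IsMarkovKernel κ] {h : ℝ → ℝ}
    (hm : Measurable h) {a : ℝ}
    (hl : ∀ t ∈ Ioo (0 : ℝ) 1, ∫ x, |(κ x).real {y | t < h y} - μ.real {y | t < h y}| ∂μ ≤ a) :
    ∫ x, |∫ y, max (min (h y) 1) 0 ∂κ x - ∫ y, max (min (h y) 1) 0 ∂μ| ∂μ ≤ a := by
  set ν : Measure ℝ := volume.restrict (Ioo (0 : ℝ) 1) with hν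
  have : IsProbabilityMeasure ν := ⟨by simp [hν]⟩
  have hFm : Measurable fun z : ℝ × ℝ => |(κ z.1).real {y | z.2 < h y} - μ.real {y | z.2 < h y}| := by
    refine ((measurable_kernel_real_lt hm).sub ?_).abs
    exact (measurable_kernel_real_lt (κ := Kernel.const ℝ μ) hm)
  have hFi : Integrable (Function.uncurry fun x t : ℝ =>
      |(κ x).real {y | t < h y} - μ.real {y | t < h y}|) (μ.prod ν) := by
    refine Integrable.of_bound (C := 1) hFm.aestronglyMeasurable (ae_of_all _ fun z => ?_)
    simp only [Function.uncurry, Real.norm_eq_abs, abs_abs]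
    exact abs_measureReal_sub_le_one _
  have hi : ∀ ρ : Measure ℝ, IsProbabilityMeasure ρ →
      Integrable (fun t => ρ.real {y | t < h y}) ν := fun ρ _ => by
    refine Integrable.of_bound (C := 1) (((measurable_kernel_real_lt
      (κ := Kernel.const ℝ ρ) hm).comp (measurable_prodMk_left (x := (0 : ℝ)))).aestronglyMeasurable)
      (ae_of_all _ fun z => ?_)
    simp only [Real.norm_eq_abs, abs_of_nonneg measureReal_nonneg]
    exact measureReal_le_one
  have hpt : ∀ x, |∫ y, max (min (h y) 1) 0 ∂κ x - ∫ y, max (min (h y) 1) 0 ∂μ|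
      ≤ ∫ t, |(κ x).real {y | t < h y} - μ.real {y | t < h y}| ∂ν := fun x => by
    rw [integral_clamp_eq _ hm, integral_clamp_eq _ hm,
      ← integral_sub (hi _ inferInstance) (hi _ inferInstance)]
    exact abs_integral_le_integral_abs
  calc _ ≤ ∫ x, ∫ t, |(κ x).real {y | t < h y} - μ.real {y | t < h y}| ∂ν ∂μ :=
        integral_mono_of_nonneg (ae_of_all _ fun x => abs_nonneg _) hFi.integral_prod_left
          (ae_of_all _ hpt)
    _ = ∫ t, ∫ x, |(κ x).real {y | t < h y} - μ.real {y | t < h y}| ∂μ ∂ν :=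
        integral_integral_swap hFi
    _ ≤ ∫ t, a ∂ν := by
        refine integral_mono_ae hFi.integral_prod_right (integrable_const _) ?_
        exact (ae_restrict_iff' measurableSet_Ioo).2 (ae_of_all _ hl)
    _ = a := by simp

lemma isLowerSet_cases {L : Set ℝ} (hL : IsLowerSet L) :
    L = ∅ ∨ L = univ ∨ ∃ t, L = Iic t ∨ L = Iio t := by
  rcases L.eq_empty_or_nonempty with h | hne
  · exact Or.inl h
  by_cases hb : BddAbove L
  · refine Or.inr (Or.inr ⟨sSup L, ?_⟩)
    have h1 : Iio (sSup L) ⊆ L := fun x hx => by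
      obtain ⟨y, hy, hxy⟩ := exists_lt_of_lt_csSup hne hx
      exact hL hxy.le hy
    by_cases h2 : sSup L ∈ L
    · exact Or.inl (Subset.antisymm (fun x hx => le_csSup hb hx) fun x hx => hL hx h2)
    · refine Or.inr (Subset.antisymm (fun x hx => lt_of_le_of_ne (le_csSup hb hx) ?_) h1)
      rintro rfl; exact h2 hx
  · refine Or.inr (Or.inl (eq_univ_of_forall fun x => ?_))
    rw [not_bddAbove_iff] at hb
    obtain ⟨y, hy, hxy⟩ := hb x
    exact hL hxy.le hy

lemma integral_abs_kernel_lowerSet_sub_le [IsProbabilityMeasure μ] [IsMarkovKernel κ] {α : ℝ}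
    (hα : ∀ t, ∫ x, |(κ x).real (Iic t) - μ.real (Iic t)| ∂μ ≤ α) {L : Set ℝ}
    (hL : IsLowerSet L) : ∫ x, |(κ x).real L - μ.real L| ∂μ ≤ α := by
  have hα0 : 0 ≤ α := (integral_nonneg fun x => abs_nonneg _).trans (hα 0)
  rcases isLowerSet_cases hL with rfl | rfl | ⟨t, rfl | rfl⟩
  · simpa
  · simpa
  · exact hα t
  · have hU : ∀ ν : Measure ℝ, IsProbabilityMeasure ν →
        Tendsto (fun n : ℕ => ν.real (Iic (t - 1 / ((n : ℝ) + 1)))) atTop (𝓝 (ν.real (Iio t))) := by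
      intro ν _
      have h1 : Iio t = ⋃ n : ℕ, Iic (t - 1 / ((n : ℝ) + 1)) := by
        ext x
        simp only [mem_Iio, mem_iUnion, mem_Iic]
        constructor
        · intro hx
          obtain ⟨n, hn⟩ := exists_nat_one_div_lt (sub_pos.2 hx)
          exact ⟨n, by linarith⟩
        · rintro ⟨n, hn⟩
          have : 0 < 1 / ((n : ℝ) + 1) := Nat.one_div_pos_of_nat
          linarith
      rw [h1]
      refine (ENNReal.tendsto_toReal (measure_ne_top _ _)).comp
        (tendsto_measure_iUnion_atTop fun n m hnm => Iic_subset_Iic.2 ?_)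
      have := Nat.one_div_le_one_div (α := ℝ) hnm
      linarith
    have h2 : Tendsto (fun n : ℕ => ∫ x, |(κ x).real (Iic (t - 1 / ((n : ℝ) + 1)))
        - μ.real (Iic (t - 1 / ((n : ℝ) + 1)))| ∂μ) atTop
        (𝓝 (∫ x, |(κ x).real (Iio t) - μ.real (Iio t)| ∂μ)) := by
      refine tendsto_integral_of_dominated_convergence (fun _ => 1)
        (fun n => (integrable_abs_kernel_real_sub measurableSet_Iic).1) (integrable_const _)
        (fun n => ae_of_all _ fun x => ?_) (ae_of_all _ fun x => ?_)
      · rw [Real.norm_eq_abs, abs_abs]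
        exact abs_measureReal_sub_le_one _
      · exact ((hU _ inferInstance).sub (hU _ inferInstance)).abs
    exact le_of_tendsto h2 (Eventually.of_forall fun n => hα _)

lemma integral_abs_kernel_ordConnected_sub_le [IsProbabilityMeasure μ] [IsMarkovKernel κ] {α : ℝ}
    (hα : ∀ t, ∫ x, |(κ x).real (Iic t) - μ.real (Iic t)| ∂μ ≤ α) {S : Set ℝ}
    (hS : S.OrdConnected) : ∫ x, |(κ x).real S - μ.real S| ∂μ ≤ 2 * α := by
  have hα0 : 0 ≤ α := (integral_nonneg fun x => abs_nonneg _).trans (hα 0)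
  rcases S.eq_empty_or_nonempty with rfl | ⟨z, hz⟩
  · simpa
  set L : Set ℝ := {x | ∃ y ∈ S, x ≤ y} with hLdef
  set L' : Set ℝ := {x | ∀ y ∈ S, x < y} with hL'def
  have hL : IsLowerSet L := fun x y hxy ⟨w, hw, h⟩ => ⟨w, hw, hxy.trans h⟩
  have hL' : IsLowerSet L' := fun x y hxy h w hw => hxy.trans_lt (h w hw)
  have hLm : MeasurableSet L := hL.ordConnected.measurableSet
  have hLm' : MeasurableSet L' := hL'.ordConnected.measurableSet
  have hsub : L' ⊆ L := fun x hx => ⟨z, hz, (hx z hz).le⟩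
  have hSL : S = L \ L' := by
    ext x
    constructor
    · intro hx
      exact ⟨⟨x, hx, le_rfl⟩, fun h => lt_irrefl _ (h x hx)⟩
    · rintro ⟨⟨y, hy, hxy⟩, h⟩
      simp only [hL'def, mem_ofPred_eq, not_forall, not_lt] at h
      obtain ⟨w, hw, hwx⟩ := h
      exact hS.out hw hy ⟨hwx, hxy⟩
  have hd : ∀ ν : Measure ℝ, IsProbabilityMeasure ν → ν.real S = ν.real L - ν.real L' :=
    fun ν _ => by rw [hSL, measureReal_sdiff hsub hLm']
  calc ∫ x, |(κ x).real S - μ.real S| ∂μ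
      ≤ ∫ x, (|(κ x).real L - μ.real L| + |(κ x).real L' - μ.real L'|) ∂μ := by
        refine integral_mono (integrable_abs_kernel_real_sub hS.measurableSet)
          ((integrable_abs_kernel_real_sub hLm).add (integrable_abs_kernel_real_sub hLm'))
          fun x => ?_
        simp only [hd _ inferInstance]
        rw [show (κ x).real L - (κ x).real L' - (μ.real L - μ.real L')
          = ((κ x).real L - μ.real L) - ((κ x).real L' - μ.real L') by ring]
        exact abs_sub _ _
    _ = _ := integral_add (integrable_abs_kernel_real_sub hLm) (integrable_abs_kernel_real_sub hLm')
    _ ≤ 2 * α := by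
        linarith [integral_abs_kernel_lowerSet_sub_le hα hL,
          integral_abs_kernel_lowerSet_sub_le hα hL']

end LevelSets

section NormalizedCovariance

variable {μ : Measure ℝ} {κ : Kernel ℝ ℝ}

lemma integrable_of_integrable_rpow_sub_one [IsFiniteMeasure μ] {q : ℝ} (hq : 1 ≤ q) {g : ℝ → ℝ}
    (hm : Measurable g) (hi : Integrable (fun x => max (|g x| ^ q - 1) 0) μ) :
    Integrable g μ := by
  refine (hi.add (integrable_const 1)).mono' hm.aestronglyMeasurable (ae_of_all _ fun x => ?_)
  rw [Real.norm_eq_abs]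
  change |g x| ≤ max (|g x| ^ q - 1) 0 + 1
  rcases le_total |g x| 1 with h | h
  · linarith [le_max_right (|g x| ^ q - 1) 0]
  · have h1 : |g x| ≤ |g x| ^ q := by
      simpa using Real.rpow_le_rpow_of_exponent_le h hq
    linarith [le_max_left (|g x| ^ q - 1) 0]

/-- The truncation of `x` to `[0, 1]`. -/
def clampUnit (x : ℝ) : ℝ := max (min x 1) 0

lemma measurable_clampUnit : Measurable clampUnit :=
  (measurable_id.min measurable_const).max measurable_const

lemma integrable_clampUnit (ν : Measure ℝ) [IsFiniteMeasure ν] {h : ℝ → ℝ} (hm : Measurable h) :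
    Integrable (fun y => clampUnit (h y)) ν := by
  refine Integrable.of_bound (C := 1) (measurable_clampUnit.comp hm).aestronglyMeasurable
    (ae_of_all _ fun x => ?_)
  rw [Real.norm_eq_abs, clampUnit, abs_of_nonneg (le_max_right _ _)]
  exact max_le (min_le_right _ _) zero_le_one

lemma abs_sub_clampUnit (x : ℝ) : |x - (clampUnit x - clampUnit (-x))| = max (|x| - 1) 0 := by
  unfold clampUnit
  rcases le_total 0 x with h | h
  · rw [max_eq_right ((min_le_left (-x) 1).trans (by linarith : -x ≤ 0)), sub_zero,
      abs_of_nonneg h, max_eq_left (le_min h zero_le_one)]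
    rcases le_total x 1 with h1 | h1
    · rw [min_eq_left h1, max_eq_right (by linarith)]; simp
    · rw [min_eq_right h1, max_eq_left (by linarith), abs_of_nonneg (by linarith)]
  · rw [max_eq_right ((min_le_left x 1).trans h), zero_sub, sub_neg_eq_add,
      abs_of_nonpos h, max_eq_left (le_min (by linarith : 0 ≤ -x) zero_le_one)]
    rcases le_total (-x) 1 with h1 | h1
    · rw [min_eq_left h1, max_eq_right (by linarith)]; simp
    · rw [min_eq_right h1, max_eq_left (by linarith), abs_of_nonpos (by linarith)]; ring

lemma integral_abs_half_sub_le [IsProbabilityMeasure μ] [IsMarkovKernel κ]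
    (h : μ.bind κ = μ) {a : ℝ}
    (hl : ∀ S : Set ℝ, S.OrdConnected → ∫ x, |(κ x).real S - μ.real S| ∂μ ≤ a)
    {g : ℝ → ℝ} (hm : Measurable g) (hg : Integrable g μ)
    (hpos : ∀ t, 0 < t → {x | t < g x}.OrdConnected)
    (hneg : ∀ t, 0 < t → {x | t < -g x}.OrdConnected) :
    ∫ x, |(∫ y, g y ∂κ x - ∫ y, g y ∂μ) / 2| ∂μ ≤ a + ∫ x, max (|g x| - 1) 0 ∂μ := by
  set e : ℝ → ℝ := fun x => g x - (clampUnit (g x) - clampUnit (-g x)) with he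
  have hei : ∀ ν : Measure ℝ, IsProbabilityMeasure ν → Integrable g ν → Integrable e ν :=
    fun ν _ h1 => h1.sub ((integrable_clampUnit ν hm).sub (integrable_clampUnit ν hm.neg))
  have heabs : ∀ x, |e x| = max (|g x| - 1) 0 := fun x => abs_sub_clampUnit (g x)
  have hdec : ∀ ν : Measure ℝ, IsProbabilityMeasure ν → Integrable g ν →
      ∫ y, g y ∂ν = ∫ y, clampUnit (g y) ∂ν - ∫ y, clampUnit (-g y) ∂ν + ∫ y, e y ∂ν := by
    intro ν _ h1
    have h2 := integral_sub (integrable_clampUnit ν hm) (integrable_clampUnit ν hm.neg)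
    have h3 := integral_sub h1 ((integrable_clampUnit ν hm).sub (integrable_clampUnit ν hm.neg))
    simp only [Pi.sub_apply, Pi.neg_apply] at h2 h3
    simp only [he]
    rw [h3, h2]; ring
  have hA := integral_abs_clamp_sub_le (μ := μ) (κ := κ) hm (a := a) fun t ht => hl _ (hpos t ht.1)
  have hB := integral_abs_clamp_sub_le (μ := μ) (κ := κ) hm.neg (a := a)
    fun t ht => hl _ (hneg t ht.1)
  set A : ℝ → ℝ := fun x => |∫ y, clampUnit (g y) ∂κ x - ∫ y, clampUnit (g y) ∂μ| with hAd
  set B : ℝ → ℝ := fun x => |∫ y, clampUnit (-g y) ∂κ x - ∫ y, clampUnit (-g y) ∂μ| with hBd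
  have hAi : Integrable A μ := ((integrable_integral_of_bind_eq h
    (integrable_clampUnit μ hm)).sub (integrable_const _)).abs
  have hBi : Integrable B μ := ((integrable_integral_of_bind_eq h
    (integrable_clampUnit μ hm.neg)).sub (integrable_const _)).abs
  have hE := (hei μ inferInstance hg).abs
  have hEi := integrable_integral_of_bind_eq h hE
  have hpt : ∀ᵐ x ∂μ, |(∫ y, g y ∂κ x - ∫ y, g y ∂μ) / 2|
      ≤ 1 / 2 * A x + 1 / 2 * B x + 1 / 2 * (∫ y, |e y| ∂κ x) + 1 / 2 * ∫ y, |e y| ∂μ := by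
    filter_upwards [ae_integrable_of_bind_eq h hg] with x hx
    rw [hdec _ inferInstance hx, hdec μ inferInstance hg, abs_div, abs_of_pos (zero_lt_two' ℝ)]
    have h1 : |∫ y, e y ∂κ x| ≤ ∫ y, |e y| ∂κ x := abs_integral_le_integral_abs
    have h2 : |∫ y, e y ∂μ| ≤ ∫ y, |e y| ∂μ := abs_integral_le_integral_abs
    have h3 : ∀ c c' d d' e e' : ℝ, |c - d + e - (c' - d' + e')|
        ≤ |c - c'| + |d - d'| + |e| + |e'| := fun c c' d d' e e' => by
      rw [show c - d + e - (c' - d' + e') = (c - c') - (d - d') + e - e' by ring]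
      exact (abs_sub _ _).trans (add_le_add ((abs_add_le _ _).trans
        (add_le_add (abs_sub _ _) le_rfl)) le_rfl)
    have h4 := h3 (∫ y, clampUnit (g y) ∂κ x) (∫ y, clampUnit (g y) ∂μ)
      (∫ y, clampUnit (-g y) ∂κ x) (∫ y, clampUnit (-g y) ∂μ) (∫ y, e y ∂κ x) (∫ y, e y ∂μ)
    simp only [hAd, hBd]
    linarith
  have hi1 : Integrable (fun x => 1 / 2 * A x + 1 / 2 * B x) μ :=
    (hAi.const_mul _).add (hBi.const_mul _)
  have hi2 : Integrable (fun x => 1 / 2 * A x + 1 / 2 * B x + 1 / 2 * (∫ y, |e y| ∂κ x)) μ :=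
    hi1.add (hEi.const_mul _)
  refine (integral_mono_of_nonneg (ae_of_all _ fun x => abs_nonneg _)
    (hi2.add (integrable_const (1 / 2 * ∫ y, |e y| ∂μ))) hpt).trans ?_
  rw [integral_add' hi2 (integrable_const _), integral_add hi1 (hEi.const_mul _),
    integral_add (hAi.const_mul _) (hBi.const_mul _), integral_const_mul, integral_const_mul,
    integral_const_mul, integral_integral_of_bind_eq h hE]
  simp only [heabs, integral_const, probReal_univ, one_smul]
  have hA' : ∫ x, A x ∂μ ≤ a := hA
  have hB' : ∫ x, B x ∂μ ≤ a := hB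
  linarith

lemma integral_rpow_mul_rpow_le_add [IsProbabilityMeasure μ] [IsMarkovKernel κ]
    (h : μ.bind κ = μ) {q : ℝ} (hq : 2 ≤ q) {a T : ℝ}
    (hl : ∀ S : Set ℝ, S.OrdConnected → ∫ x, |(κ x).real S - μ.real S| ∂μ ≤ a)
    {g₁ g₂ : ℝ → ℝ} (hm₁ : Measurable g₁) (hm₂ : Measurable g₂)
    (hpos : ∀ t, 0 < t → {x | t < g₂ x}.OrdConnected)
    (hneg : ∀ t, 0 < t → {x | t < -g₂ x}.OrdConnected)
    (hi₁ : Integrable (fun x => max (|g₁ x| ^ q - 1) 0) μ)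
    (hi₂ : Integrable (fun x => max (|g₂ x| ^ q - 1) 0) μ)
    (hT₁ : ∫ x, max (|g₁ x| ^ q - 1) 0 ∂μ ≤ T) (hT₂ : ∫ x, max (|g₂ x| ^ q - 1) 0 ∂μ ≤ T) :
    Integrable (fun x => |(g₁ x - ∫ y, g₁ y ∂μ) / 2| ^ (q / 2)
        * |(∫ y, g₂ y ∂κ x - ∫ y, g₂ y ∂μ) / 2| ^ (q / 2)) μ ∧
      ∫ x, |(g₁ x - ∫ y, g₁ y ∂μ) / 2| ^ (q / 2)
        * |(∫ y, g₂ y ∂κ x - ∫ y, g₂ y ∂μ) / 2| ^ (q / 2) ∂μ ≤ a + T := by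
  have hq1 : 1 ≤ q := by linarith
  have hq0 : 0 < q := by linarith
  have hg₁ := integrable_of_integrable_rpow_sub_one hq1 hm₁ hi₁
  have hg₂ := integrable_of_integrable_rpow_sub_one hq1 hm₂ hi₂
  set A : ℝ → ℝ := fun x => (g₁ x - ∫ y, g₁ y ∂μ) / 2 with hA
  set B : ℝ → ℝ := fun x => (∫ y, g₂ y ∂κ x - ∫ y, g₂ y ∂μ) / 2 with hB
  have hAi : Integrable A μ := (hg₁.sub (integrable_const _)).div_const 2
  have hBi : Integrable B μ :=
    ((integrable_integral_of_bind_eq h hg₂).sub (integrable_const _)).div_const 2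
  have hconv := convexOn_abs_rpow_sub_one hq1
  have hid : μ.bind (Kernel.id : Kernel ℝ ℝ) = μ := Measure.id_comp
  have hφA := integral_convex_half_sub_le (κ := Kernel.id) hid hconv (by simp)
    (fun x => le_max_right _ _) hg₁ hi₁
  simp only [Kernel.id_apply, integral_dirac] at hφA
  have hφB := integral_convex_half_sub_le h hconv (by simp) (fun x => le_max_right _ _) hg₂ hi₂
  have hg₂' : Integrable (fun x => max (|g₂ x| - 1) 0) μ :=
    ((hg₂.abs.sub (integrable_const 1)).sup (integrable_const 0))
  have hRi : Integrable (fun x => rpowExcess q (g₂ x)) μ := (hi₂.div_const q).sub hg₂'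
  have hRB := integral_convex_half_sub_le h (convexOn_rpowExcess hq1)
    (fun x => by simp [rpowExcess]) (rpowExcess_nonneg hq1) hg₂ hRi
  have hEB := integral_abs_half_sub_le h hl hm₂ hg₂ hpos hneg
  have hR₂ : ∫ x, rpowExcess q (g₂ x) ∂μ
      = (∫ x, max (|g₂ x| ^ q - 1) 0 ∂μ) / q - ∫ x, max (|g₂ x| - 1) 0 ∂μ := by
    rw [← integral_div, ← integral_sub (hi₂.div_const q) hg₂']; rfl
  change Integrable (fun x => max (|A x| ^ q - 1) 0) μ ∧ _ at hφA
  change Integrable (fun x => max (|B x| ^ q - 1) 0) μ ∧ _ at hφB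
  change Integrable (fun x => rpowExcess q (B x)) μ ∧ _ at hRB
  have hmin : ∀ x : ℝ, min |x| 1 = |x| + rpowExcess q x - max (|x| ^ q - 1) 0 / q := fun x => by
    unfold rpowExcess
    rcases le_total |x| 1 with h1 | h1
    · rw [min_eq_left h1, max_eq_right (by linarith : |x| - 1 ≤ 0)]; ring
    · rw [min_eq_right h1, max_eq_left (by linarith : 0 ≤ |x| - 1)]; ring
  have hpt : ∀ x, |A x| ^ (q / 2) * |B x| ^ (q / 2) ≤ |B x| + rpowExcess q (B x)
      + max (|A x| ^ q - 1) 0 / 2 + max (|B x| ^ q - 1) 0 * (1 / 2 - 1 / q) := fun x => by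
    have h1 := rpow_mul_rpow_le_min_add (r := q / 2) (by linarith) (abs_nonneg (A x))
      (abs_nonneg (B x))
    rw [mul_div_cancel₀ q (two_ne_zero' ℝ), hmin] at h1
    refine h1.trans (le_of_eq ?_)
    ring
  have hs1 : Integrable (fun x => |B x| + rpowExcess q (B x)) μ := hBi.abs.add hRB.1
  have hs2 : Integrable (fun x => |B x| + rpowExcess q (B x) + max (|A x| ^ q - 1) 0 / 2) μ :=
    hs1.add (hφA.1.div_const 2)
  have hs3 := hs2.add (hφB.1.mul_const (1 / 2 - 1 / q))
  have hn : ∀ x, 0 ≤ |A x| ^ (q / 2) * |B x| ^ (q / 2) := fun x => by positivity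
  have hI : Integrable (fun x => |A x| ^ (q / 2) * |B x| ^ (q / 2)) μ := by
    refine hs3.mono' ?_ (ae_of_all _ fun x => ?_)
    · exact (hAi.abs.1.aemeasurable.pow_const _).mul (hBi.abs.1.aemeasurable.pow_const _)
        |>.aestronglyMeasurable
    · rw [Real.norm_eq_abs, abs_of_nonneg (hn x)]
      exact hpt x
  refine ⟨hI, (integral_mono hI hs3 hpt).trans ?_⟩
  rw [integral_add' hs2 (hφB.1.mul_const _), integral_add hs1 (hφA.1.div_const 2),
    integral_add hBi.abs hRB.1, integral_div, integral_mul_const]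
  have h1 : (0 : ℝ) ≤ 1 / 2 - 1 / q := sub_nonneg.2 (one_div_le_one_div_of_le two_pos hq)
  have h2 := mul_le_mul_of_nonneg_right (hφB.2.trans hT₂) h1
  have h3 := hφA.2.trans hT₁
  have h4 : (∫ x, max (|g₂ x| ^ q - 1) 0 ∂μ) / q ≤ T / q := div_le_div_of_nonneg_right hT₂ hq0.le
  have h5 := hRB.2
  rw [hR₂] at h5
  simp only [hA, hB] at *
  have h6 : T * (1 / 2 - 1 / q) = T / 2 - T / q := by ring
  linarith

end NormalizedCovariance

section MonotoneClass

variable {μ : Measure ℝ} {M : ℝ} {p : ℝ≥0∞} {g : ℝ → ℝ}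

lemma Mon.neg (hg : Mon M p μ g) : Mon M p μ fun x => -g x := by
  obtain ⟨⟨I, hI, hIc, hmon, h0⟩, ht⟩ := hg
  refine ⟨⟨I, hI, hIc, ?_, fun x hx => by simp [h0 x hx]⟩, by simpa only [abs_neg] using ht⟩
  rcases hmon with h | h
  · exact Or.inr h.neg
  · exact Or.inl h.neg

lemma Mon.ordConnected_lt (hg : Mon M p μ g) {t : ℝ} (ht : 0 ≤ t) :
    {x | t < g x}.OrdConnected := by
  obtain ⟨⟨I, -, hIc, hmon, h0⟩, -⟩ := hg
  have hI : ∀ x, t < g x → x ∈ I := fun x hx => by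
    by_contra h
    rw [h0 x h] at hx
    exact absurd hx (not_lt.2 ht)
  refine ⟨fun x hx z hz y hy => ?_⟩
  have hyI := hIc.out (hI x hx) (hI z hz) hy
  rcases hmon with h | h
  · exact lt_of_lt_of_le hx (h (hI x hx) hyI hy.1)
  · exact lt_of_lt_of_le hz (h hyI (hI z hz) hy.2)

lemma Mon.measurable (hg : Mon M p μ g) : Measurable g := by
  refine measurable_of_Ioi fun t => ?_
  rcases le_or_gt 0 t with ht | ht
  · exact (hg.ordConnected_lt ht).measurableSet
  · have h1 : g ⁻¹' Ioi t = (⋂ n : ℕ, {x | -t * (1 - 1 / ((n : ℝ) + 1)) < -g x})ᶜ := by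
      ext x
      simp only [mem_preimage, mem_Ioi, mem_compl_iff, mem_iInter, mem_ofPred_eq, not_forall,
        not_lt]
      constructor
      · intro hx
        obtain ⟨n, hn⟩ := exists_nat_one_div_lt (div_pos (sub_pos.2 hx) (neg_pos.2 ht))
        refine ⟨n, ?_⟩
        rw [lt_div_iff₀ (neg_pos.2 ht)] at hn
        linarith
      · rintro ⟨n, hn⟩
        have : 0 < 1 / ((n : ℝ) + 1) := Nat.one_div_pos_of_nat
        nlinarith [mul_pos (neg_pos.2 ht) this]
    rw [h1]
    refine (MeasurableSet.iInter fun n => (hg.neg.ordConnected_lt ?_).measurableSet).compl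
    refine mul_nonneg (by linarith) (sub_nonneg.2 ?_)
    have := Nat.one_div_le_one_div (α := ℝ) (Nat.zero_le n)
    simpa using this

lemma lintegral_Ioi_one_add_rpow {b : ℝ} (hb : 1 < b) :
    ∫⁻ t in Ioi (0 : ℝ), ENNReal.ofReal ((t + 1) ^ (-b)) = ENNReal.ofReal (1 / (b - 1)) := by
  have hi : IntegrableOn (fun t : ℝ => (t + 1) ^ (-b)) (Ioi 0) :=
    integrableOn_add_rpow_Ioi_of_lt (by linarith) (by norm_num)
  rw [← ofReal_integral_eq_lintegral_ofReal hi ((ae_restrict_iff' measurableSet_Ioi).2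
    (ae_of_all _ fun t ht => Real.rpow_nonneg (by linarith [mem_Ioi.1 ht]) _))]
  congr 1
  have hd : ∀ x ∈ Ici (0 : ℝ),
      HasDerivAt (fun t => (t + 1) ^ (-b + 1) / (-b + 1)) ((x + 1) ^ (-b)) x := fun x hx => by
    have h1 := ((hasDerivAt_id x).add_const 1).rpow_const (p := -b + 1)
      (Or.inl (by simp only [id]; linarith [mem_Ici.1 hx]))
    have h2 := h1.div_const (-b + 1)
    have h3 : -b + 1 ≠ 0 := by linarith
    simp only [id, one_mul, add_sub_cancel_right] at h2
    rwa [mul_div_cancel_left₀ _ h3] at h2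
  have ht : Tendsto (fun t : ℝ => (t + 1) ^ (-b + 1) / (-b + 1)) atTop (𝓝 (0 / (-b + 1))) := by
    have h1 := (tendsto_rpow_neg_atTop (by linarith : 0 < b - 1)).comp
      (tendsto_atTop_add_const_right atTop (1 : ℝ) tendsto_id)
    refine Tendsto.div_const ?_ _
    simpa [Function.comp_def, sub_eq_add_neg, add_comm] using h1
  rw [integral_Ioi_of_hasDerivAt_of_tendsto (hd 0 self_mem_Ici).continuousAt.continuousWithinAt
    (fun x hx => hd x (mem_Ici.2 (le_of_lt hx))) hi ht]
  have h3 : -b + 1 ≠ 0 := by linarith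
  have h4 : b - 1 ≠ 0 := by linarith
  rw [zero_add, Real.one_rpow]
  field_simp
  ring

/-- The normalisation `M a ^ (-1/p)` of the class `Mon M p μ`. -/
def monScale (M : ℝ) (p : ℝ≥0∞) (a : ℝ) : ℝ := M * a ^ (-(1 / p).toReal)

lemma monScale_pos (hM : 0 < M) {a : ℝ} (ha : 0 < a) : 0 < monScale M p a :=
  mul_pos hM (Real.rpow_pos_of_pos ha _)

lemma q_mul_one_div_lt_one {q : ℝ} (hq : 2 ≤ q) (hqp : ENNReal.ofReal q < p) :
    q * (1 / p).toReal < 1 := by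
  rcases eq_or_ne p ∞ with rfl | hp
  · simp
  · have h1 : q < p.toReal := (ENNReal.ofReal_lt_iff_lt_toReal (by linarith) hp).1 hqp
    rw [ENNReal.toReal_div, ENNReal.toReal_one, mul_one_div, div_lt_one (by linarith)]
    exact h1

lemma Mon.integral_rpow_sub_one_le [IsProbabilityMeasure μ] (hg : Mon M p μ g) (hM : 0 < M)
    {q : ℝ} (hq : 2 ≤ q) (hqp : ENNReal.ofReal q < p) {a : ℝ} (ha : 0 < a) :
    Integrable (fun x => max (|g x / monScale M p a| ^ q - 1) 0) μ ∧
      ∫ x, max (|g x / monScale M p a| ^ q - 1) 0 ∂μ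
        ≤ a * ((1 - q * (1 / p).toReal)⁻¹ - 1) := by
  have hw := monScale_pos (p := p) hM ha
  have hq0 : 0 < q := by linarith
  have hlt := q_mul_one_div_lt_one hq hqp
  have hτ : 0 ≤ (1 / p).toReal := ENNReal.toReal_nonneg
  have hC : 0 ≤ a * ((1 - q * (1 / p).toReal)⁻¹ - 1) :=
    mul_nonneg ha.le (sub_nonneg.2 ((one_le_inv₀ (by linarith)).2 (by nlinarith)))
  have hm : Measurable fun x => max (|g x / monScale M p a| ^ q - 1) 0 :=
    (((hg.measurable.div_const _).abs.pow_const q).sub_const 1).max measurable_const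
  have hkey : ∫⁻ x, ENNReal.ofReal (max (|g x / monScale M p a| ^ q - 1) 0) ∂μ
      ≤ ENNReal.ofReal (a * ((1 - q * (1 / p).toReal)⁻¹ - 1)) := by
    rcases eq_or_ne p ∞ with rfl | hp
    · have h1 := hg.2
      rw [if_pos rfl] at h1
      have h2 : ∀ᵐ x ∂μ, |g x| ≤ M := by
        rw [ae_iff]; simpa only [not_le] using h1
      refine le_trans (le_of_eq ?_) zero_le
      rw [lintegral_eq_zero_iff (hm.ennreal_ofReal)]
      filter_upwards [h2] with x hx
      have h3 : |g x / monScale M ∞ a| ≤ 1 := by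
        simp only [monScale, ENNReal.div_top, ENNReal.toReal_zero, neg_zero, Real.rpow_zero,
          mul_one]
        rwa [abs_div, abs_of_pos hM, div_le_one hM]
      have h4 := Real.rpow_le_one (abs_nonneg _) h3 hq0.le
      simp only [Pi.zero_apply, ENNReal.ofReal_eq_zero]
      exact max_le (by linarith) le_rfl
    · have h1 := hg.2
      rw [if_neg hp] at h1
      set π := p.toReal with hπ
      have hqπ : q < π := (ENNReal.ofReal_lt_iff_lt_toReal hq0.le hp).1 hqp
      have hπ0 : 0 < π := by linarith
      have hτe : (1 / p).toReal = 1 / π := by rw [ENNReal.toReal_div, ENNReal.toReal_one]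
      rw [lintegral_eq_lintegral_meas_lt μ
        (f := fun x => max (|g x / monScale M p a| ^ q - 1) 0)
        (ae_of_all _ fun x => le_max_right _ _) hm.aemeasurable]
      have h2 : ∀ t ∈ Ioi (0 : ℝ), μ {x | t < max (|g x / monScale M p a| ^ q - 1) 0}
          ≤ ENNReal.ofReal a * ENNReal.ofReal ((t + 1) ^ (-(π / q))) := by
        intro t ht
        have ht0 : 0 < t := ht
        have hs : 0 < (t + 1) ^ (1 / q) := Real.rpow_pos_of_pos (by linarith) _
        have h3 : {x | t < max (|g x / monScale M p a| ^ q - 1) 0}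
            ⊆ {x | monScale M p a * (t + 1) ^ (1 / q) < |g x|} := by
          intro x hx
          have hx' : t < |g x / monScale M p a| ^ q - 1 := by
            rcases lt_max_iff.1 (mem_ofPred_eq ▸ hx) with h | h
            · exact h
            · exact absurd h (not_lt.2 ht0.le)
          have h4 : (t + 1) ^ (1 / q) < |g x / monScale M p a| := by
            have h5 := Real.rpow_lt_rpow (by linarith) (by linarith :
              t + 1 < |g x / monScale M p a| ^ q) (by positivity : 0 < 1 / q)
            rwa [← Real.rpow_mul (abs_nonneg _), mul_one_div_cancel hq0.ne', Real.rpow_one] at h5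
          rw [abs_div, abs_of_pos hw, lt_div_iff₀ hw, mul_comm] at h4
          exact h4
        refine (measure_mono h3).trans ((h1 _ (mul_pos hw hs)).trans (le_of_eq ?_))
        rw [← ENNReal.ofReal_mul ha.le]
        congr 1
        rw [Real.mul_rpow hw.le hs.le, monScale, hτe, Real.mul_rpow hM.le
          (Real.rpow_nonneg ha.le _), ← Real.rpow_mul ha.le, ← Real.rpow_mul (by linarith),
          Real.rpow_neg hM.le]
        have h6 : -(1 / π) * -π = 1 := by field_simp
        have h7 : 1 / q * -π = -(π / q) := by ring
        rw [h6, h7, Real.rpow_one]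
        have h8 := (Real.rpow_pos_of_pos hM π).ne'
        field_simp
      refine (setLIntegral_mono' measurableSet_Ioi h2).trans (le_of_eq ?_)
      have hb : 1 < π / q := (one_lt_div hq0).2 hqπ
      rw [lintegral_const_mul' _ _ ENNReal.ofReal_ne_top, lintegral_Ioi_one_add_rpow hb,
        ← ENNReal.ofReal_mul ha.le, hτe]
      congr 2
      have h9 : π - q ≠ 0 := by linarith
      have h10 : π / q - 1 ≠ 0 := by linarith
      have h11 : 1 - q * (1 / π) ≠ 0 := by rw [hτe] at hlt; linarith
      have h12 : π / q - 1 = (π - q) / q := by field_simp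
      have h13 : 1 - q * (1 / π) = (π - q) / π := by field_simp
      rw [h12, h13]
      field_simp
      ring
  have hnn : 0 ≤ᵐ[μ] fun x => max (|g x / monScale M p a| ^ q - 1) 0 :=
    ae_of_all _ fun x => le_max_right _ _
  have hi : Integrable (fun x => max (|g x / monScale M p a| ^ q - 1) 0) μ := by
    refine ⟨hm.aestronglyMeasurable, ?_⟩
    rw [hasFiniteIntegral_iff_ofReal hnn]
    exact lt_of_le_of_lt hkey ENNReal.ofReal_lt_top
  refine ⟨hi, ?_⟩
  rw [integral_eq_lintegral_of_nonneg_ae hnn hi.1]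
  exact ENNReal.toReal_le_of_le_ofReal hC hkey

end MonotoneClass

section MonCovariance

variable {μ : Measure ℝ} {κ : Kernel ℝ ℝ} {M : ℝ} {p : ℝ≥0∞}

lemma eLpNorm_le_ofReal_of_integral_le {α : Type*} [MeasurableSpace α] {ν : Measure α} {r : ℝ}
    (hr : 0 < r) {F : α → ℝ} (hF : AEStronglyMeasurable F ν)
    (hi : Integrable (fun x => |F x| ^ r) ν) {C : ℝ} (hC : 0 ≤ C)
    (hle : ∫ x, |F x| ^ r ∂ν ≤ C ^ r) :
    MemLp F (ENNReal.ofReal r) ν ∧ eLpNorm F (ENNReal.ofReal r) ν ≤ ENNReal.ofReal C := by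
  have hL : MemLp F (ENNReal.ofReal r) ν := (memLp_ofReal_iff hr hF).2 hi
  refine ⟨hL, ?_⟩
  rw [hL.eLpNorm_eq_integral_rpow_norm (by simpa using hr) ENNReal.ofReal_ne_top,
    ENNReal.toReal_ofReal hr.le]
  refine ENNReal.ofReal_le_ofReal ?_
  calc (∫ x, ‖F x‖ ^ r ∂ν) ^ r⁻¹ ≤ (C ^ r) ^ r⁻¹ :=
        Real.rpow_le_rpow (integral_nonneg fun x => Real.rpow_nonneg (norm_nonneg _) _) hle
          (inv_nonneg.2 hr.le)
    _ = C := by rw [← Real.rpow_mul hC, mul_inv_cancel₀ hr.ne', Real.rpow_one]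

/-- The bound for the covariance of two functions of `Mon M p μ` in `L^(q/2)`. -/
def covBound (M : ℝ) (p : ℝ≥0∞) (q a : ℝ) : ℝ :=
  4 * M ^ 2 * ((1 - q * (1 / p).toReal)⁻¹) ^ (2 / q) * a ^ (2 * (1 / q - (1 / p).toReal))

lemma covBound_nonneg {q : ℝ} (hq : 2 ≤ q) (hqp : ENNReal.ofReal q < p) {a : ℝ} (ha : 0 ≤ a) :
    0 ≤ covBound M p q a := by
  have h1 : 0 ≤ (1 - q * (1 / p).toReal)⁻¹ :=
    inv_nonneg.2 (by linarith [q_mul_one_div_lt_one hq hqp])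
  have h2 := Real.rpow_nonneg h1 (2 / q)
  have h3 := Real.rpow_nonneg ha (2 * (1 / q - (1 / p).toReal))
  unfold covBound
  positivity

lemma continuous_covBound {q : ℝ} (hq : 2 ≤ q) (hqp : ENNReal.ofReal q < p) :
    Continuous (covBound M p q) := by
  have h1 := q_mul_one_div_lt_one hq hqp
  have h2 : 0 ≤ 1 / q - (1 / p).toReal := by
    rw [sub_nonneg, le_div_iff₀ (by linarith)]
    linarith
  exact continuous_const.mul (Real.continuous_rpow_const (mul_nonneg zero_le_two h2))

lemma Mon.integrable [IsProbabilityMeasure μ] {g : ℝ → ℝ} (hg : Mon M p μ g) (hM : 0 < M)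
    {q : ℝ} (hq : 2 ≤ q) (hqp : ENNReal.ofReal q < p) : Integrable g μ := by
  have hw := (monScale_pos (p := p) hM one_pos).ne'
  have h1 := integrable_of_integrable_rpow_sub_one (by linarith)
    (hg.measurable.div_const (monScale M p 1))
    (hg.integral_rpow_sub_one_le hM hq hqp one_pos).1
  refine (h1.mul_const (monScale M p 1)).congr (ae_of_all _ fun x => ?_)
  simp only
  rw [div_mul_cancel₀ _ hw]

lemma Mon.eLpNorm_le [IsProbabilityMeasure μ] {g : ℝ → ℝ} (hg : Mon M p μ g) (hM : 0 < M)
    {q : ℝ} (hq : 2 ≤ q) (hqp : ENNReal.ofReal q < p) :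
    eLpNorm g (ENNReal.ofReal q) μ
      ≤ ENNReal.ofReal (M * ((1 - q * (1 / p).toReal)⁻¹) ^ (1 / q)) := by
  have hq0 : 0 < q := by linarith
  obtain ⟨h1, h2⟩ := hg.integral_rpow_sub_one_le hM hq hqp one_pos
  have hscale : monScale M p 1 = M := by simp [monScale]
  rw [hscale] at h1 h2
  have hD : 0 ≤ (1 - q * (1 / p).toReal)⁻¹ :=
    inv_nonneg.2 (by linarith [q_mul_one_div_lt_one hq hqp])
  have hMq : 0 ≤ M ^ q := Real.rpow_nonneg hM.le _
  have hpt : ∀ x, |g x| ^ q ≤ M ^ q * (max (|g x / M| ^ q - 1) 0 + 1) := fun x => by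
    have h3 : |g x| ^ q = M ^ q * |g x / M| ^ q := by
      rw [← Real.mul_rpow hM.le (abs_nonneg _), abs_div, abs_of_pos hM, mul_div_cancel₀ _ hM.ne']
    rw [h3]
    exact mul_le_mul_of_nonneg_left (by linarith [le_max_left (|g x / M| ^ q - 1) 0]) hMq
  have hi' := (h1.add (integrable_const 1)).const_mul (M ^ q)
  have hi : Integrable (fun x => |g x| ^ q) μ := by
    refine hi'.mono' (hg.measurable.abs.pow_const q).aestronglyMeasurable
      (ae_of_all _ fun x => ?_)
    rw [Real.norm_eq_abs, abs_of_nonneg (Real.rpow_nonneg (abs_nonneg _) _)]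
    exact hpt x
  refine (eLpNorm_le_ofReal_of_integral_le hq0 hg.measurable.aestronglyMeasurable hi
    (mul_nonneg hM.le (Real.rpow_nonneg hD _)) ?_).2
  refine (integral_mono hi hi' hpt).trans ?_
  rw [integral_const_mul, integral_add' h1 (integrable_const _),
    Real.mul_rpow hM.le (Real.rpow_nonneg hD _), ← Real.rpow_mul hD, one_div_mul_cancel hq0.ne',
    Real.rpow_one]
  refine mul_le_mul_of_nonneg_left ?_ hMq
  simp only [integral_const, probReal_univ, one_smul]
  linarith

lemma Mon.eLpNorm_cov_le_of_pos [IsProbabilityMeasure μ] [IsMarkovKernel κ] (h : μ.bind κ = μ)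
    (hM : 0 < M) {q : ℝ} (hq : 2 ≤ q) (hqp : ENNReal.ofReal q < p) {a : ℝ} (ha : 0 < a)
    (hl : ∀ S : Set ℝ, S.OrdConnected → ∫ x, |(κ x).real S - μ.real S| ∂μ ≤ a)
    {g₁ g₂ : ℝ → ℝ} (hg₁ : Mon M p μ g₁) (hg₂ : Mon M p μ g₂) :
    eLpNorm (fun x => (g₁ x - ∫ y, g₁ y ∂μ) * (∫ y, g₂ y ∂κ x - ∫ y, g₂ y ∂μ))
      (ENNReal.ofReal (q / 2)) μ ≤ ENNReal.ofReal (covBound M p q a) := by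
  have hw := monScale_pos (p := p) hM ha
  set w := monScale M p a with hwdef
  have hq0 : 0 < q := by linarith
  obtain ⟨hi₁, hT₁⟩ := hg₁.integral_rpow_sub_one_le hM hq hqp ha
  obtain ⟨hi₂, hT₂⟩ := hg₂.integral_rpow_sub_one_le hM hq hqp ha
  have hlev : ∀ g : ℝ → ℝ, Mon M p μ g → ∀ t, 0 < t → {x | t < g x / w}.OrdConnected :=
    fun g hg t ht => by
      have := hg.ordConnected_lt (mul_nonneg ht.le hw.le)
      simpa only [lt_div_iff₀ hw] using this
  have key := integral_rpow_mul_rpow_le_add h hq hl (hg₁.measurable.div_const w)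
    (hg₂.measurable.div_const w) (hlev _ hg₂)
    (fun t ht => by simpa only [neg_div] using hlev _ hg₂.neg t ht) hi₁ hi₂ hT₁ hT₂
  simp only [integral_div] at key
  have hpt : ∀ u v u' v' : ℝ, |(u - u') * (v - v')| ^ (q / 2)
      = (2 * w) ^ q * (|(u / w - u' / w) / 2| ^ (q / 2) * |(v / w - v' / w) / 2| ^ (q / 2)) := by
    intro u v u' v'
    have h2w : 0 ≤ 2 * w := by linarith
    rw [← Real.mul_rpow (abs_nonneg _) (abs_nonneg _), ← abs_mul]
    have h3 : (2 * w) ^ q = ((2 * w) * (2 * w)) ^ (q / 2) := by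
      rw [Real.mul_rpow h2w h2w, ← Real.rpow_add (by linarith)]
      congr 1; ring
    rw [h3, ← Real.mul_rpow (mul_nonneg h2w h2w) (abs_nonneg _),
      ← abs_of_nonneg (mul_nonneg h2w h2w), ← abs_mul]
    congr 2
    field_simp
  have hD1 := q_mul_one_div_lt_one hq hqp
  have hD : 0 < (1 - q * (1 / p).toReal)⁻¹ := inv_pos.2 (by linarith)
  have hmeas : AEStronglyMeasurable
      (fun x => (g₁ x - ∫ y, g₁ y ∂μ) * (∫ y, g₂ y ∂κ x - ∫ y, g₂ y ∂μ)) μ :=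
    ((hg₁.measurable.sub_const _).aestronglyMeasurable).mul
      ((integrable_integral_of_bind_eq h (hg₂.integrable hM hq hqp)).1.sub
        aestronglyMeasurable_const)
  refine (eLpNorm_le_ofReal_of_integral_le (by linarith : 0 < q / 2) hmeas ?_
    (covBound_nonneg hq hqp ha.le) ?_).2
  · simp only [hpt]
    exact key.1.const_mul _
  · simp only [hpt]
    rw [integral_const_mul]
    refine (mul_le_mul_of_nonneg_left key.2 (Real.rpow_nonneg (by linarith) _)).trans
      (le_of_eq ?_)
    have h4 : (4 * M ^ 2 : ℝ) ^ (q / 2) = 2 ^ q * M ^ q := by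
      rw [show (4 * M ^ 2 : ℝ) = (2 * M) ^ (2 : ℝ) by rw [Real.rpow_two]; ring,
        ← Real.rpow_mul (by positivity), mul_div_cancel₀ q (two_ne_zero' ℝ),
        Real.mul_rpow zero_le_two hM.le]
    have h5 : ((2 : ℝ) / q) * (q / 2) = 1 := by field_simp
    have h6 : 2 * (1 / q - (1 / p).toReal) * (q / 2) = 1 - q * (1 / p).toReal := by
      field_simp
    have h7 : -(1 / p).toReal * q = -(q * (1 / p).toReal) := by ring
    have h8 : covBound M p q a ^ (q / 2)
        = 2 ^ q * M ^ q * (1 - q * (1 / p).toReal)⁻¹ * a ^ (1 - q * (1 / p).toReal) := by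
      rw [covBound, Real.mul_rpow (by positivity) (Real.rpow_nonneg ha.le _),
        Real.mul_rpow (by positivity) (by positivity), h4, ← Real.rpow_mul hD.le, h5,
        ← Real.rpow_mul ha.le, h6, Real.rpow_one]
    have h9 : (2 * w) ^ q = 2 ^ q * M ^ q * a ^ (-(q * (1 / p).toReal)) := by
      rw [hwdef, monScale, Real.mul_rpow zero_le_two (by positivity),
        Real.mul_rpow hM.le (by positivity), ← Real.rpow_mul ha.le, h7]
      ring
    rw [h8, h9, sub_eq_add_neg 1 (q * (1 / p).toReal), Real.rpow_add ha, Real.rpow_one]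
    ring

lemma Mon.eLpNorm_cov_le [IsProbabilityMeasure μ] [IsMarkovKernel κ] (h : μ.bind κ = μ)
    (hM : 0 < M) {q : ℝ} (hq : 2 ≤ q) (hqp : ENNReal.ofReal q < p) {α : ℝ}
    (hα : ∀ t, ∫ x, |(κ x).real (Iic t) - μ.real (Iic t)| ∂μ ≤ α)
    {g₁ g₂ : ℝ → ℝ} (hg₁ : Mon M p μ g₁) (hg₂ : Mon M p μ g₂) :
    eLpNorm (fun x => (g₁ x - ∫ y, g₁ y ∂μ) * (∫ y, g₂ y ∂κ x - ∫ y, g₂ y ∂μ))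
      (ENNReal.ofReal (q / 2)) μ ≤ ENNReal.ofReal (covBound M p q (2 * α)) := by
  have hα0 : 0 ≤ α := (integral_nonneg fun x => abs_nonneg _).trans (hα 0)
  have hc : Tendsto (fun a => ENNReal.ofReal (covBound M p q a)) (𝓝[>] (2 * α))
      (𝓝 (ENNReal.ofReal (covBound M p q (2 * α)))) :=
    ((ENNReal.continuous_ofReal.comp (continuous_covBound hq hqp)).tendsto _).mono_left
      nhdsWithin_le_nhds
  refine ge_of_tendsto hc (eventually_mem_nhdsWithin.mono fun a ha => ?_)
  have ha' : 2 * α < a := ha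
  exact Mon.eLpNorm_cov_le_of_pos h hM hq hqp (by linarith)
    (fun S hS => (integral_abs_kernel_ordConnected_sub_le hα hS).trans ha'.le) hg₁ hg₂

end MonCovariance

section ClassCExtension

variable {μ : Measure ℝ} {κ : Kernel ℝ ℝ} {M : ℝ} {p : ℝ≥0∞}

lemma eLpNorm_finset_sum_mul_le {α ι : Type*} [MeasurableSpace α] {ν : Measure α} {r C : ℝ≥0∞}
    (hr : 1 ≤ r) (s : Finset ι) {c : ι → ℝ} {F : ι → α → ℝ}
    (hF : ∀ i, AEStronglyMeasurable (F i) ν) (hC : ∀ i, eLpNorm (F i) r ν ≤ C)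
    (hc : ∑ i ∈ s, |c i| ≤ 1) : eLpNorm (fun x => ∑ i ∈ s, c i * F i x) r ν ≤ C := by
  have h1 : (fun x => ∑ i ∈ s, c i * F i x) = ∑ i ∈ s, c i • F i := by
    ext x; simp
  rw [h1]
  calc eLpNorm (∑ i ∈ s, c i • F i) r ν ≤ ∑ i ∈ s, eLpNorm (c i • F i) r ν :=
        eLpNorm_sum_le (fun i _ => (hF i).const_smul _) hr
    _ ≤ ∑ i ∈ s, ENNReal.ofReal |c i| * C := Finset.sum_le_sum fun i _ => by
        rw [eLpNorm_const_smul, Real.enorm_eq_ofReal_abs]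
        exact mul_le_mul_right (hC i) _
    _ = ENNReal.ofReal (∑ i ∈ s, |c i|) * C := by
        rw [← Finset.sum_mul, ENNReal.ofReal_sum_of_nonneg fun i _ => abs_nonneg _]
    _ ≤ 1 * C := by
        gcongr
        exact ENNReal.ofReal_le_one.2 hc
    _ = C := one_mul C

lemma eLpNorm_le_of_tendsto_ae {α : Type*} [MeasurableSpace α] {ν : Measure α} {r C : ℝ≥0∞}
    {F : ℕ → α → ℝ} {G : α → ℝ} (hF : ∀ n, AEStronglyMeasurable (F n) ν)
    (hC : ∀ n, eLpNorm (F n) r ν ≤ C)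
    (hlim : ∀ᵐ x ∂ν, Tendsto (fun n => F n x) atTop (𝓝 (G x))) : eLpNorm G r ν ≤ C :=
  (Lp.eLpNorm_lim_le_liminf_eLpNorm hF G hlim).trans
    (liminf_le_of_le (by isBoundedDefault) fun b hb => by
      obtain ⟨n, hn⟩ := hb.exists
      exact hn.trans (hC n))

lemma eLpNorm_sum_cov_le [IsProbabilityMeasure μ] [IsMarkovKernel κ] (h : μ.bind κ = μ)
    (hM : 0 < M) {q : ℝ} (hq : 2 ≤ q) (hqp : ENNReal.ofReal q < p) {α : ℝ}
    (hα : ∀ t, ∫ x, |(κ x).real (Iic t) - μ.real (Iic t)| ∂μ ≤ α)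
    {n : ℕ} {a : Fin n → ℝ} {g : Fin n → ℝ → ℝ} (ha : ∑ i, |a i| ≤ 1)
    (hg : ∀ i, Mon M p μ (g i)) :
    eLpNorm (fun x => (∑ i, a i * g i x - ∫ y, ∑ i, a i * g i y ∂μ)
        * (∫ y, ∑ i, a i * g i y ∂κ x - ∫ y, ∑ i, a i * g i y ∂μ)) (ENNReal.ofReal (q / 2)) μ
      ≤ ENNReal.ofReal (covBound M p q (2 * α)) := by
  have hint : ∀ i, Integrable (g i) μ := fun i => (hg i).integrable hM hq hqp
  set F : Fin n × Fin n → ℝ → ℝ := fun i x =>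
    (g i.1 x - ∫ y, g i.1 y ∂μ) * (∫ y, g i.2 y ∂κ x - ∫ y, g i.2 y ∂μ) with hF
  have hFm : ∀ i, AEStronglyMeasurable (F i) μ := fun i =>
    ((hint i.1).1.sub aestronglyMeasurable_const).mul
      ((integrable_integral_of_bind_eq h (hint i.2)).1.sub aestronglyMeasurable_const)
  have hsum : ∑ i : Fin n × Fin n, |a i.1 * a i.2| ≤ 1 := by
    rw [Fintype.sum_prod_type]
    simp only [abs_mul]
    simp_rw [← Finset.mul_sum]
    rw [← Finset.sum_mul]
    exact mul_le_one₀ ha (Finset.sum_nonneg fun i _ => abs_nonneg _) ha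
  have hmean : ∀ ν : Measure ℝ, (∀ i, Integrable (g i) ν) →
      ∫ y, ∑ i, a i * g i y ∂ν = ∑ i, a i * ∫ y, g i y ∂ν := fun ν hν => by
    rw [integral_finsetSum _ fun i _ => (hν i).const_mul (a i)]
    simp only [integral_const_mul]
  have heq : (fun x => (∑ i, a i * g i x - ∫ y, ∑ i, a i * g i y ∂μ)
        * (∫ y, ∑ i, a i * g i y ∂κ x - ∫ y, ∑ i, a i * g i y ∂μ))
      =ᵐ[μ] fun x => ∑ i : Fin n × Fin n, (a i.1 * a i.2) * F i x := by
    have hk : ∀ᵐ x ∂μ, ∀ i, Integrable (g i) (κ x) :=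
      ae_all_iff.2 fun i => ae_integrable_of_bind_eq h (hint i)
    filter_upwards [hk] with x hx
    rw [hmean _ hx, hmean _ hint, ← Finset.sum_sub_distrib, ← Finset.sum_sub_distrib,
      Finset.sum_mul_sum, Fintype.sum_prod_type]
    refine Finset.sum_congr rfl fun i _ => Finset.sum_congr rfl fun j _ => ?_
    simp only [hF]
    ring
  rw [eLpNorm_congr_ae heq]
  exact eLpNorm_finset_sum_mul_le (by rw [ENNReal.one_le_ofReal]; linarith) _ hFm
    (fun i => Mon.eLpNorm_cov_le h hM hq hqp hα (hg i.1) (hg i.2)) hsum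

lemma ClassC.congr {f f' : ℝ → ℝ} (hf : ClassC M p μ f) (h : f =ᵐ[μ] f') : ClassC M p μ f' := by
  refine ⟨hf.1.congr h, fun ε hε => ?_⟩
  obtain ⟨n, a, g, ha, hg, hlt⟩ := hf.2 ε hε
  refine ⟨n, a, g, ha, hg, lt_of_eq_of_lt (integral_congr_ae ?_) hlt⟩
  filter_upwards [h] with x hx
  rw [hx]

/-- An approximating sequence in the definition of `ClassC`, converging almost everywhere together
with its image under a kernel. -/
lemma ClassC.exists_seq [IsProbabilityMeasure μ] [IsMarkovKernel κ] (h : μ.bind κ = μ)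
    (hM : 0 < M) {q : ℝ} (hq : 2 ≤ q) (hqp : ENNReal.ofReal q < p) {f : ℝ → ℝ}
    (hf : ClassC M p μ f) :
    ∃ F : ℕ → ℝ → ℝ, (∀ n, Integrable (F n) μ) ∧
      (∀ n, ∃ (m : ℕ) (a : Fin m → ℝ) (g : Fin m → ℝ → ℝ), ∑ i, |a i| ≤ 1 ∧
        (∀ i, Mon M p μ (g i)) ∧ F n = fun x => ∑ i, a i * g i x) ∧
      (∀ᵐ x ∂μ, Tendsto (fun n => F n x) atTop (𝓝 (f x))) ∧
      (∀ᵐ x ∂μ, Tendsto (fun n => ∫ y, F n y ∂κ x) atTop (𝓝 (∫ y, f y ∂κ x))) ∧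
      Tendsto (fun n => ∫ y, F n y ∂μ) atTop (𝓝 (∫ y, f y ∂μ)) := by
  choose m a g ha hg hlt using fun n : ℕ => hf.2 (1 / ((n : ℝ) + 1)) Nat.one_div_pos_of_nat
  set F : ℕ → ℝ → ℝ := fun n x => ∑ i, a n i * g n i x with hF
  have hFi : ∀ n, Integrable (F n) μ := fun n =>
    integrable_finsetSum _ fun i _ => ((hg n i).integrable hM hq hqp).const_mul _
  have hdi : ∀ n, Integrable (fun x => |f x - F n x|) μ := fun n => (hf.1.sub (hFi n)).abs
  set ψ : ℕ → ℝ → ℝ := fun n x => |f x - F n x| + ∫ y, |f y - F n y| ∂κ x with hψ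
  have hψi : ∀ n, Integrable (ψ n) μ := fun n =>
    (hdi n).add (integrable_integral_of_bind_eq h (hdi n))
  have hψ0 : ∀ n x, 0 ≤ ψ n x := fun n x =>
    add_nonneg (abs_nonneg _) (integral_nonneg fun y => abs_nonneg _)
  have hlim0 : Tendsto (fun n : ℕ => 1 / ((n : ℝ) + 1)) atTop (𝓝 0) :=
    tendsto_one_div_add_atTop_nhds_zero_nat
  have hdlim : Tendsto (fun n => ∫ x, |f x - F n x| ∂μ) atTop (𝓝 0) :=
    squeeze_zero (fun n => integral_nonneg fun x => abs_nonneg _) (fun n => (hlt n).le) hlim0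
  have hψlim : Tendsto (fun n => ∫ x, ψ n x ∂μ) atTop (𝓝 0) := by
    have h1 : ∀ n, ∫ x, ψ n x ∂μ = ∫ x, |f x - F n x| ∂μ + ∫ x, |f x - F n x| ∂μ := fun n => by
      simp only [hψ]
      rw [integral_add (hdi n) (integrable_integral_of_bind_eq h (hdi n)),
        integral_integral_of_bind_eq h (hdi n)]
    simp only [h1]
    simpa using hdlim.add hdlim
  have hmeas : TendstoInMeasure μ ψ atTop 0 := by
    refine tendstoInMeasure_of_tendsto_eLpNorm one_ne_zero (fun n => (hψi n).1)
      aestronglyMeasurable_zero ?_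
    have h2 : ∀ n, eLpNorm (ψ n - 0) 1 μ = ENNReal.ofReal (∫ x, ψ n x ∂μ) := fun n => by
      rw [sub_zero, eLpNorm_one_eq_lintegral_enorm,
        ← ofReal_integral_norm_eq_lintegral_enorm (hψi n)]
      simp only [Real.norm_eq_abs, abs_of_nonneg (hψ0 n _)]
    simp only [h2]
    simpa [Function.comp_def] using (ENNReal.continuous_ofReal.tendsto 0).comp hψlim
  obtain ⟨ns, hns, hae⟩ := hmeas.exists_seq_tendsto_ae
  have hFk : ∀ᵐ x ∂μ, ∀ n, Integrable (F n) (κ x) :=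
    ae_all_iff.2 fun n => ae_integrable_of_bind_eq h (hFi n)
  refine ⟨fun n => F (ns n), fun n => hFi _, fun n => ⟨m (ns n), a (ns n), g (ns n), ha _, hg _,
    rfl⟩, ?_, ?_, ?_⟩
  · filter_upwards [hae] with x hx
    rw [tendsto_iff_norm_sub_tendsto_zero]
    refine squeeze_zero (fun n => norm_nonneg _) (fun n => ?_) hx
    rw [Real.norm_eq_abs, abs_sub_comm]
    exact le_add_of_nonneg_right (integral_nonneg fun y => abs_nonneg _)
  · filter_upwards [hae, hFk, ae_integrable_of_bind_eq h hf.1] with x hx hFx hfx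
    rw [tendsto_iff_norm_sub_tendsto_zero]
    refine squeeze_zero (fun n => norm_nonneg _) (fun n => ?_) hx
    rw [Real.norm_eq_abs, abs_sub_comm, ← integral_sub hfx (hFx _)]
    exact abs_integral_le_integral_abs.trans (le_add_of_nonneg_left (abs_nonneg _))
  · rw [tendsto_iff_norm_sub_tendsto_zero]
    refine squeeze_zero (fun n => norm_nonneg _) (fun n => ?_) (hdlim.comp hns.tendsto_atTop)
    rw [Real.norm_eq_abs, abs_sub_comm, ← integral_sub hf.1 (hFi _)]
    exact abs_integral_le_integral_abs

lemma ClassC.memLp [IsProbabilityMeasure μ] (hM : 0 < M) {q : ℝ} (hq : 2 ≤ q)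
    (hqp : ENNReal.ofReal q < p) {f : ℝ → ℝ} (hf : ClassC M p μ f) :
    MemLp f (ENNReal.ofReal q) μ := by
  have hid : μ.bind (Kernel.id : Kernel ℝ ℝ) = μ := Measure.id_comp
  obtain ⟨F, hFi, hF, hlim, -, -⟩ := hf.exists_seq hid hM hq hqp
  refine ⟨hf.1.1, lt_of_le_of_lt (eLpNorm_le_of_tendsto_ae
    (C := ENNReal.ofReal (M * ((1 - q * (1 / p).toReal)⁻¹) ^ (1 / q)))
    (fun n => (hFi n).1) (fun n => ?_) hlim) ENNReal.ofReal_lt_top⟩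
  obtain ⟨m, a, g, ha, hg, hFn⟩ := hF n
  rw [hFn]
  exact eLpNorm_finset_sum_mul_le (by rw [ENNReal.one_le_ofReal]; linarith) _
    (fun i => (hg i).measurable.aestronglyMeasurable)
    (fun i => (hg i).eLpNorm_le hM hq hqp) ha

lemma ClassC.eLpNorm_cov_le [IsProbabilityMeasure μ] [IsMarkovKernel κ] (h : μ.bind κ = μ)
    (hM : 0 < M) {q : ℝ} (hq : 2 ≤ q) (hqp : ENNReal.ofReal q < p) {α : ℝ}
    (hα : ∀ t, ∫ x, |(κ x).real (Iic t) - μ.real (Iic t)| ∂μ ≤ α) {f : ℝ → ℝ}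
    (hf : ClassC M p μ f) :
    eLpNorm (fun x => (f x - ∫ y, f y ∂μ) * (∫ y, f y ∂κ x - ∫ y, f y ∂μ))
      (ENNReal.ofReal (q / 2)) μ ≤ ENNReal.ofReal (covBound M p q (2 * α)) := by
  obtain ⟨F, hFi, hF, hlim, hκ, hμ⟩ := hf.exists_seq h hM hq hqp
  refine eLpNorm_le_of_tendsto_ae
    (F := fun n x => (F n x - ∫ y, F n y ∂μ) * (∫ y, F n y ∂κ x - ∫ y, F n y ∂μ))
    (fun n => ((hFi n).1.sub aestronglyMeasurable_const).mul
      ((integrable_integral_of_bind_eq h (hFi n)).1.sub aestronglyMeasurable_const))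
    (fun n => ?_) ?_
  · obtain ⟨m, a, g, ha, hg, hFn⟩ := hF n
    rw [hFn]
    exact eLpNorm_sum_cov_le h hM hq hqp hα ha hg
  · filter_upwards [hlim, hκ] with x hx hx'
    exact (hx.sub hμ).mul (hx'.sub hμ)

end ClassCExtension

section MarkovChain

/-- The `n`-step transition kernel of `K`. -/
def kernelIter (K : Kernel ℝ ℝ) : ℕ → Kernel ℝ ℝ
  | 0 => Kernel.id
  | n + 1 => kernelIter K n ∘ₖ K

variable {K : Kernel ℝ ℝ}

instance [IsMarkovKernel K] (n : ℕ) : IsMarkovKernel (kernelIter K n) := by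
  induction n with
  | zero => exact inferInstanceAs (IsMarkovKernel Kernel.id)
  | succ n ih => exact inferInstanceAs (IsMarkovKernel (kernelIter K n ∘ₖ K))

lemma bind_kernelIter {μ : Measure ℝ} (h : μ.bind K = μ) (n : ℕ) :
    μ.bind (kernelIter K n) = μ := by
  induction n with
  | zero => exact Measure.id_comp
  | succ n ih => rw [kernelIter, ← Measure.comp_assoc, h, ih]

lemma integrable_of_abs_le {α : Type*} [MeasurableSpace α] {ν : Measure α} [IsFiniteMeasure ν]
    {g : α → ℝ} (hg : Measurable g) {C : ℝ} (hC : ∀ x, |g x| ≤ C) : Integrable g ν :=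
  Integrable.of_bound hg.aestronglyMeasurable C (ae_of_all _ hC)

lemma Kop_iterate_eq_integral [IsMarkovKernel K] {g : ℝ → ℝ} (hg : Measurable g) {C : ℝ} (hC : ∀ x, |g x| ≤ C)
    (n : ℕ) (x : ℝ) : (Kop K)^[n] g x = ∫ y, g y ∂kernelIter K n x := by
  induction n generalizing x with
  | zero => simp [kernelIter, Kernel.id_apply]
  | succ n ih =>
    rw [Function.iterate_succ_apply', kernelIter,
      Kernel.integral_comp (integrable_of_abs_le hg hC), Kop]
    simp only [ih]

lemma integral_indic {ν : Measure ℝ} (t : ℝ) : ∫ y, indic t y ∂ν = ν.real (Iic t) :=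
  integral_indicator_one measurableSet_Iic

lemma integral_abs_kernelIter_Iic_sub_le [IsMarkovKernel K] {μ : Measure ℝ}
    [IsProbabilityMeasure μ] (n : ℕ) (t : ℝ) : ∫ x, |(kernelIter K n x).real (Iic t) - μ.real (Iic t)| ∂μ
      ≤ alpha1 (Kop K) μ n := by
  have hm : ∀ t, Measurable (indic t) := fun t => measurable_const.indicator measurableSet_Iic
  have hb : ∀ t x, |indic t x| ≤ 1 := fun t x => by
    unfold indic indicator
    split_ifs <;> simp
  have h1 : ∀ t, ∫ x, |(Kop K)^[n] (indic t) x - ∫ y, indic t y ∂μ| ∂μ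
      = ∫ x, |(kernelIter K n x).real (Iic t) - μ.real (Iic t)| ∂μ := fun t => by
    simp only [Kop_iterate_eq_integral (hm t) (hb t), integral_indic]
  rw [alpha1, ← h1]
  refine le_ciSup (f := fun t => ∫ x, |(Kop K)^[n] (indic t) x - ∫ y, indic t y ∂μ| ∂μ)
    ⟨1, ?_⟩ t
  rintro _ ⟨s, rfl⟩
  simp only [h1]
  calc ∫ x, |(kernelIter K n x).real (Iic s) - μ.real (Iic s)| ∂μ ≤ ∫ _, (1 : ℝ) ∂μ :=
        integral_mono_of_nonneg (ae_of_all _ fun _ => abs_nonneg _) (integrable_const _)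
          (ae_of_all _ fun x => abs_measureReal_sub_le_one _)
    _ = 1 := by simp

lemma integral_bind_kernel {ν : Measure ℝ} {g : ℝ → ℝ} (hg : Integrable g (ν.bind K)) :
    ∫ x, g x ∂ν.bind K = ∫ x, ∫ y, g y ∂K x ∂ν := by
  have h1 : (K ∘ₖ Kernel.const Unit ν) () = ν.bind K := by
    rw [Kernel.comp_apply, Kernel.const_apply]
  rw [← h1, Kernel.integral_comp (by rwa [h1]), Kernel.const_apply]

/-- The `σ`-algebra generated by `X 0, …, X n`. -/
abbrev pastSigma {Ω : Type*} (X : ℕ → Ω → ℝ) (n : ℕ) : MeasurableSpace Ω :=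
  MeasurableSpace.comap (fun ω => fun i : Fin (n + 1) => X i.1 ω) inferInstance

lemma measurable_pastSigma {Ω : Type*} (X : ℕ → Ω → ℝ) {i n : ℕ} (h : i ≤ n) :
    Measurable[pastSigma X n] (X i) := by
  have h1 : Measurable[pastSigma X n] (fun ω => fun i : Fin (n + 1) => X i.1 ω) :=
    comap_measurable _
  exact (measurable_pi_apply (⟨i, by omega⟩ : Fin (n + 1))).comp h1

lemma pastSigma_mono {Ω : Type*} (X : ℕ → Ω → ℝ) {m n : ℕ} (h : m ≤ n) :
    pastSigma X m ≤ pastSigma X n := by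
  refine Measurable.comap_le ?_
  exact @measurable_pi_lambda _ _ _ (pastSigma X n) _ _ fun i : Fin (m + 1) =>
    measurable_pastSigma X (by omega)

variable {Ω : Type*} [MeasurableSpace Ω] {P : Measure Ω} {X : ℕ → Ω → ℝ}

lemma pastSigma_le (hXm : ∀ i, Measurable (X i)) (n : ℕ) :
    pastSigma X n ≤ (inferInstance : MeasurableSpace Ω) :=
  (measurable_pi_lambda _ fun i : Fin (n + 1) => hXm i.1).comap_le

/-- The Markov property of the process `X` with transition kernel `K`. -/
def HasMarkovProperty (P : Measure Ω) (X : ℕ → Ω → ℝ) (K : Kernel ℝ ℝ) : Prop :=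
  ∀ n : ℕ, ∀ g : ℝ → ℝ, Measurable g → (∃ C, ∀ x, |g x| ≤ C) →
    P[fun ω => g (X (n + 1) ω) | pastSigma X n] =ᵐ[P] fun ω => Kop K g (X n ω)

variable [IsProbabilityMeasure P] [IsMarkovKernel K]

lemma setIntegral_comp_eq_setIntegral_Kop_iterate (hXm : ∀ i, Measurable (X i))
    (hMarkov : HasMarkovProperty P X K) (j k : ℕ) {g : ℝ → ℝ} (hg : Measurable g)
    {C : ℝ} (hC : ∀ x, |g x| ≤ C) {s : Set Ω} (hs : MeasurableSet[pastSigma X j] s) :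
    ∫ ω in s, g (X (j + k) ω) ∂P = ∫ ω in s, (Kop K)^[k] g (X j ω) ∂P := by
  induction k generalizing g with
  | zero => rfl
  | succ k ih =>
    have h1 := hMarkov (j + k) g hg ⟨C, hC⟩
    have hle := pastSigma_le (Ω := Ω) hXm (j + k)
    have hs' := pastSigma_mono X (Nat.le_add_right j k) s hs
    rw [Function.iterate_succ_apply, ← ih (g := Kop K g), ← add_assoc,
      ← setIntegral_condExp hle (f := fun ω => g (X (j + k + 1) ω))
        (integrable_of_abs_le (hg.comp (hXm _)) fun ω => hC _) hs']
    · exact integral_congr_ae (ae_restrict_of_ae h1)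
    · exact (hg.stronglyMeasurable.integral_kernel (κ := K)).measurable
    · intro x
      rw [Kop]
      have := norm_integral_le_of_norm_le_const (f := g) (C := C) (μ := K x) (ae_of_all _ hC)
      simpa using this

lemma map_restrict_eq_bind_kernelIter (hXm : ∀ i, Measurable (X i))
    (hMarkov : HasMarkovProperty P X K) (j k : ℕ) {s : Set Ω}
    (hs : MeasurableSet[pastSigma X j] s) :
    (P.restrict s).map (X (j + k)) = ((P.restrict s).map (X j)).bind (kernelIter K k) := by
  ext B hB
  have hg : Measurable (B.indicator (1 : ℝ → ℝ)) := measurable_one.indicator hB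
  have hb : ∀ x, |B.indicator (1 : ℝ → ℝ) x| ≤ 1 := fun x => by
    unfold indicator
    split_ifs <;> simp
  have h1 := setIntegral_comp_eq_setIntegral_Kop_iterate hXm hMarkov j k hg hb hs
  simp only [Kop_iterate_eq_integral hg hb, integral_indicator_one hB] at h1
  have h2 : (fun ω => B.indicator (1 : ℝ → ℝ) (X (j + k) ω))
      = (X (j + k) ⁻¹' B).indicator 1 := rfl
  rw [h2, integral_indicator_one (hXm _ hB)] at h1
  rw [Measure.bind_apply hB (kernelIter K k).measurable.aemeasurable,
    lintegral_map ((kernelIter K k).measurable_coe hB) (hXm j), Measure.map_apply (hXm _) hB,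
    ← ENNReal.ofReal_toReal (measure_ne_top (P.restrict s) _)]
  rw [Measure.real] at h1
  rw [h1, ofReal_integral_eq_lintegral_ofReal]
  · refine lintegral_congr fun ω => ?_
    rw [Measure.real, ENNReal.ofReal_toReal (measure_ne_top _ _)]
  · refine integrable_of_abs_le (C := 1)
      (((kernelIter K k).measurable_coe hB).ennreal_toReal.comp (hXm j)) fun ω => ?_
    rw [abs_of_nonneg measureReal_nonneg]
    exact measureReal_le_one
  · exact ae_of_all _ fun ω => measureReal_nonneg

lemma condExp_comp_eq_integral_kernelIter (hXm : ∀ i, Measurable (X i))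
    (hMarkov : HasMarkovProperty P X K) {μ : Measure ℝ} [IsProbabilityMeasure μ]
    (h : μ.bind K = μ) (hlaw : ∀ i, P.map (X i) = μ) (j k : ℕ) {g : ℝ → ℝ} (hg : Measurable g)
    (hgi : Integrable g μ) :
    P[fun ω => g (X (j + k) ω) | pastSigma X j]
      =ᵐ[P] fun ω => ∫ y, g y ∂kernelIter K k (X j ω) := by
  have hκm : StronglyMeasurable fun x => ∫ y, g y ∂kernelIter K k x :=
    hg.stronglyMeasurable.integral_kernel
  have hκi := integrable_integral_of_bind_eq (bind_kernelIter h k) hgi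
  have hci : ∀ (i : ℕ) {φ : ℝ → ℝ}, Integrable φ μ → Integrable (fun ω => φ (X i ω)) P :=
    fun i φ hφ => by
      rw [← hlaw i] at hφ
      exact hφ.comp_measurable (hXm i)
  refine (ae_eq_condExp_of_forall_setIntegral_eq (pastSigma_le hXm j) (hci _ hgi)
    (fun s _ _ => (hci j hκi).integrableOn) (fun s hs _ => ?_) ?_).symm
  · have h1 := map_restrict_eq_bind_kernelIter hXm hMarkov j k hs
    have h2 : Integrable g ((P.restrict s).map (X (j + k))) :=
      (integrable_map_measure hg.aestronglyMeasurable (hXm _).aemeasurable).2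
        (hci _ hgi).integrableOn
    have h3 := h2
    rw [h1] at h3
    rw [← integral_map (hXm _).aemeasurable hg.aestronglyMeasurable (μ := P.restrict s), h1,
      integral_bind_kernel h3, integral_map (hXm j).aemeasurable hκm.aestronglyMeasurable]
  · exact (hκm.measurable.comp (measurable_pastSigma X le_rfl)).aestronglyMeasurable

lemma integral_mul_comp_eq (hXm : ∀ i, Measurable (X i))
    (hMarkov : HasMarkovProperty P X K) {μ : Measure ℝ} [IsProbabilityMeasure μ]
    (h : μ.bind K = μ) (hlaw : ∀ i, P.map (X i) = μ) (j k : ℕ) {g : ℝ → ℝ} (hg : Measurable g)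
    (hgi : Integrable g μ) {D : Ω → ℝ} (hD : Measurable[pastSigma X j] D)
    (hDi : Integrable (fun ω => D ω * g (X (j + k) ω)) P) :
    ∫ ω, D ω * g (X (j + k) ω) ∂P = ∫ ω, D ω * ∫ y, g y ∂kernelIter K k (X j ω) ∂P := by
  have hgi' : Integrable (fun ω => g (X (j + k) ω)) P := by
    rw [← hlaw (j + k)] at hgi
    exact hgi.comp_measurable (hXm _)
  rw [← integral_condExp (pastSigma_le hXm j)]
  refine integral_congr_ae ((condExp_mul_of_stronglyMeasurable_left hD.stronglyMeasurable hDi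
    hgi').trans ?_)
  filter_upwards [condExp_comp_eq_integral_kernelIter hXm hMarkov h hlaw j k hg hgi] with ω hω
  rw [Pi.mul_apply, hω]

end MarkovChain

section MomentInequality

variable {K : Kernel ℝ ℝ} {Ω : Type*} [MeasurableSpace Ω] {P : Measure Ω} {X : ℕ → Ω → ℝ}
  {μ : Measure ℝ} {M q : ℝ} {p : ℝ≥0∞}

lemma integral_rpow_le_of_eLpNorm_le {r C : ℝ} (hr : 0 < r) (hC : 0 ≤ C) {Z : Ω → ℝ}
    (hZ : MemLp Z (ENNReal.ofReal r) P) (h : eLpNorm Z (ENNReal.ofReal r) P ≤ ENNReal.ofReal C) :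
    (∫ ω, |Z ω| ^ r ∂P) ^ (1 / r) ≤ C := by
  rw [hZ.eLpNorm_eq_integral_rpow_norm (by simpa using hr) ENNReal.ofReal_ne_top,
    ENNReal.toReal_ofReal hr.le, ENNReal.ofReal_le_ofReal_iff hC] at h
  simpa only [Real.norm_eq_abs, one_div] using h

/-- The bounds on the projective terms, as a function of the time lag. -/
def lagBound (K : Kernel ℝ ℝ) (μ : Measure ℝ) (M : ℝ) (p : ℝ≥0∞) (q : ℝ) (f : ℝ → ℝ) : ℕ → ℝ
  | 0 => (∫ x, |f x - ∫ y, f y ∂μ| ^ q ∂μ) ^ (2 / q)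
  | k + 1 => covBound M p q (2 * alpha1 (Kop K) μ (k + 1))

lemma lagBound_nonneg (hq : 2 ≤ q) (hqp : ENNReal.ofReal q < p) (f : ℝ → ℝ) (k : ℕ) :
    0 ≤ lagBound K μ M p q f k := by
  cases k with
  | zero =>
    exact Real.rpow_nonneg (integral_nonneg fun x => Real.rpow_nonneg (abs_nonneg _) _) _
  | succ k =>
    refine covBound_nonneg hq hqp (mul_nonneg zero_le_two ?_)
    exact Real.iSup_nonneg fun t => integral_nonneg fun x => abs_nonneg _

lemma integral_abs_sum_comp_rpow_le [IsMarkovKernel K] [IsProbabilityMeasure P]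
    [IsProbabilityMeasure μ] (hXm : ∀ i, Measurable (X i)) (hMarkov : HasMarkovProperty P X K)
    (h : μ.bind K = μ) (hlaw : ∀ i, P.map (X i) = μ)
    (hM : 0 < M) (hq : 2 ≤ q) (hqp : ENNReal.ofReal q < p) {f : ℝ → ℝ} (hfm : Measurable f)
    (hf : ClassC M p μ f) (N : ℕ) :
    (∫ ω, |∑ i ∈ Finset.range N, (f (X (i + 1) ω) - ∫ y, f y ∂μ)| ^ q ∂P) ^ (2 / q)
      ≤ 2 * (q - 1) * ∑ n ∈ Finset.range N, ∑ i ∈ Finset.range (N - n),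
          lagBound K μ M p q f i := by
  have hq0 : 0 < q := by linarith
  set m : ℝ := ∫ y, f y ∂μ with hm
  have hfL : MemLp (fun x => f x - m) (ENNReal.ofReal q) μ :=
    (hf.memLp hM hq hqp).sub (memLp_const m)
  have hgm : Measurable fun x => f x - m := hfm.sub_const m
  have hgi : Integrable (fun x => f x - m) μ := hf.1.sub (integrable_const m)
  set Y : ℕ → Ω → ℝ := fun i ω => f (X (i + 1) ω) - m with hY
  have hYm : ∀ i, Measurable (Y i) := fun i => hgm.comp (hXm _)
  have hmp : ∀ i, MeasurePreserving (X i) P μ := fun i => ⟨hXm i, hlaw i⟩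
  have hYL : ∀ i, MemLp (Y i) (ENNReal.ofReal q) P := fun i =>
    hfL.comp_measurePreserving (hmp (i + 1))
  refine integral_abs_sum_rpow_le hq hYm hYL (lagBound_nonneg hq hqp f) (fun n => ?_)
    (fun n j hj => ?_) N
  · refine le_of_eq ?_
    have h1 : ∫ ω, |Y n ω| ^ q ∂P = ∫ x, |f x - m| ^ q ∂μ := by
      rw [← hlaw (n + 1), integral_map (f := fun x => |f x - m| ^ q) (hXm _).aemeasurable
        (hgm.norm.pow_const q).aestronglyMeasurable]
    rw [h1, lagBound]
  · obtain ⟨k, rfl⟩ : ∃ k, n = j + (k + 1) := ⟨n - j - 1, by omega⟩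
    set κ := kernelIter K (k + 1) with hκ
    have hbind : μ.bind κ = μ := bind_kernelIter h _
    set γ : ℝ → ℝ := fun x => ∫ y, f y ∂κ x - m with hγ
    have hγm : Measurable γ :=
      (hfm.stronglyMeasurable.integral_kernel (κ := κ)).measurable.sub_const m
    have hcov := hf.eLpNorm_cov_le hbind hM hq hqp (integral_abs_kernelIter_Iic_sub_le (k + 1))
    have hprodm : AEStronglyMeasurable (fun x => (f x - m) * γ x) μ :=
      (hgm.mul hγm).aestronglyMeasurable
    have hprodL : MemLp (fun x => (f x - m) * γ x) (ENNReal.ofReal (q / 2)) μ :=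
      ⟨hprodm, hcov.trans_lt ENNReal.ofReal_lt_top⟩
    have hYGL : MemLp (fun ω => Y j ω * γ (X (j + 1) ω)) (ENNReal.ofReal (q / 2)) P :=
      hprodL.comp_measurePreserving (hmp (j + 1))
    refine ⟨fun ω => γ (X (j + 1) ω), hγm.comp (hXm _), hYGL, ?_, ?_⟩
    · have h1 := eLpNorm_comp_measurePreserving (p := ENNReal.ofReal (q / 2)) hprodm (hmp (j + 1))
      have h2 := integral_rpow_le_of_eLpNorm_le (by linarith : 0 < q / 2)
        (lagBound_nonneg (K := K) (μ := μ) (M := M) hq hqp f (k + 1)) hYGL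
        (h1.le.trans hcov)
      rw [one_div_div] at h2
      rwa [Nat.add_sub_cancel_left]
    · set S : ℕ → Ω → ℝ := fun n ω => ∑ i ∈ Finset.range n, Y i ω with hS
      have hSm : ∀ n ≤ j + 1, Measurable[pastSigma X (j + 1)] (S n) := fun n hn =>
        Finset.measurable_sum _ fun i hi => hgm.comp
          (measurable_pastSigma X (by have := Finset.mem_range.1 hi; omega))
      have hDm : Measurable[pastSigma X (j + 1)]
          (fun ω => signedPow q (S (j + 1) ω) - signedPow q (S j ω)) :=
        ((continuous_signedPow hq).measurable.comp (hSm _ le_rfl)).sub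
          ((continuous_signedPow hq).measurable.comp (hSm _ (Nat.le_succ j)))
      have hSY : ∀ n i, Integrable (fun ω => signedPow q (S n ω) * Y i ω) P := fun n i =>
        integrable_signedPow_mul hq (Finset.measurable_sum _ fun i _ => hYm i)
          (memLp_finsetSum _ fun i _ => hYL i) (hYm i) (hYL i)
      have hDY : Integrable (fun ω => (signedPow q (S (j + 1) ω) - signedPow q (S j ω))
          * (f (X (j + 1 + (k + 1)) ω) - m)) P := by
        refine ((hSY (j + 1) (j + (k + 1))).sub (hSY j (j + (k + 1)))).congr
          (ae_of_all _ fun ω => ?_)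
        have h3 : j + 1 + (k + 1) = j + (k + 1) + 1 := by ring
        simp only [hY, Pi.sub_apply, h3]
        ring
      have h4 := integral_mul_comp_eq hXm hMarkov h hlaw (j + 1) (k + 1) hgm hgi hDm hDY
      have h5 : (∫ ω, (signedPow q (S (j + 1) ω) - signedPow q (S j ω)) * γ (X (j + 1) ω) ∂P)
          = ∫ ω, (signedPow q (S (j + 1) ω) - signedPow q (S j ω)) * Y (j + (k + 1)) ω ∂P := by
        have h3 : j + 1 + (k + 1) = j + (k + 1) + 1 := by ring
        simp only [hY, ← h3]
        rw [h4]
        have h6 : ∀ᵐ ω ∂P, Integrable f (κ (X (j + 1) ω)) :=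
          (hmp (j + 1)).quasiMeasurePreserving.ae (ae_integrable_of_bind_eq hbind hf.1)
        refine integral_congr_ae ?_
        filter_upwards [h6] with ω hω
        rw [integral_sub hω (integrable_const m)]
        simp [hγ]
      simp only [← abs_mul]
      exact h5.symm.le.trans ((le_abs_self _).trans abs_integral_le_integral_abs)

lemma sum_range_sum_range_sub (a : ℕ → ℝ) (N : ℕ) :
    ∑ n ∈ Finset.range N, ∑ i ∈ Finset.range (N - n), a i
      = N * a 0 + ∑ k ∈ Finset.Icc 1 (N - 1), ((N : ℝ) - k) * a k := by
  have h1 : ∑ n ∈ Finset.range N, ∑ i ∈ Finset.range (N - n), a i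
      = ∑ i ∈ Finset.range N, ((N : ℝ) - i) * a i := by
    rw [Finset.sum_comm' (t' := Finset.range N) (s' := fun i => Finset.range (N - i))
      (fun x y => by simp only [Finset.mem_range]; omega)]
    refine Finset.sum_congr rfl fun i hi => ?_
    rw [Finset.sum_const, Finset.card_range, nsmul_eq_mul,
      Nat.cast_sub (Finset.mem_range.1 hi).le]
  rw [h1]
  cases N with
  | zero => simp
  | succ N =>
    rw [Finset.sum_range_succ', Nat.add_sub_cancel, add_comm, Nat.cast_zero, sub_zero,
      Finset.range_eq_Ico, Finset.sum_Ico_add' (fun k : ℕ => (((N + 1 : ℕ) : ℝ) - k) * a k)]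
    rfl

lemma toReal_inv_one_sub_div (hq : 2 ≤ q) (hqp : ENNReal.ofReal q < p) :
    ((1 - ENNReal.ofReal q / p)⁻¹).toReal = (1 - q * (1 / p).toReal)⁻¹ := by
  have hp0 : p ≠ 0 := (bot_le.trans_lt hqp).ne'
  rw [ENNReal.toReal_inv, ENNReal.toReal_sub_of_le _ ENNReal.one_ne_top, ENNReal.toReal_one,
    div_eq_mul_one_div, ENNReal.toReal_mul, ENNReal.toReal_ofReal (by linarith)]
  exact ENNReal.div_le_of_le_mul (by rw [one_mul]; exact hqp.le)

lemma toReal_one_div_sub_one_div (hq : 2 ≤ q) (hqp : ENNReal.ofReal q < p) :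
    (1 / ENNReal.ofReal q - 1 / p).toReal = 1 / q - (1 / p).toReal := by
  have hq0 : 0 < q := by linarith
  rw [ENNReal.toReal_sub_of_le, ENNReal.toReal_div, ENNReal.toReal_one,
    ENNReal.toReal_ofReal hq0.le]
  · rw [one_div, one_div]
    exact ENNReal.inv_le_inv.2 hqp.le
  · simpa using hq0

end MomentInequality

/-- Theorem 5, moment inequality: for a stationary Markov
chain, `f ∈ C(M,p,μ)` with `p > 2`, and `2 ≤ q < p`,
`‖Σ_{i=1}^n (f(X_i) − μ(f))‖_q ≤ √(2q) (n‖f(X_0)−μ(f)‖_q²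
  + 4M²(p/(p−q))^{2/q} Σ_{k=1}^{n−1}(n−k)(2α_1(k))^{2(p−q)/(pq)})^{1/2}`.
For `p = ∞` the exponents are read as limits `2(p−q)/(pq) = 2/q`,
`(p/(p−q))^{2/q} = 1`, which is how the `ℝ≥0∞`-valued formulas behave. -/
theorem statement16 {Ω : Type*} [MeasurableSpace Ω] (P : Measure Ω)
    [IsProbabilityMeasure P] (X : ℕ → Ω → ℝ) (hXm : ∀ i, Measurable (X i))
    (μ : Measure ℝ) [IsProbabilityMeasure μ]
    (K : Kernel ℝ ℝ) [IsMarkovKernel K] (hinv : μ.bind (fun x => K x) = μ)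
    (hX0 : Measure.map (X 0) P = μ)
    (hMarkov : ∀ n : ℕ, ∀ g : ℝ → ℝ, Measurable g → (∃ C, ∀ x, |g x| ≤ C) →
      P[fun ω => g (X (n + 1) ω)
          | MeasurableSpace.comap (fun ω => fun i : Fin (n + 1) => X i.1 ω) inferInstance]
        =ᵐ[P] fun ω => Kop K g (X n ω))
    (hstat : ∀ k n : ℕ,
      Measure.map (fun ω => fun i : Fin n => X (i.1 + k) ω) P
        = Measure.map (fun ω => fun i : Fin n => X i.1 ω) P)
    (M : ℝ) (hM : 0 < M) (p : ℝ≥0∞) (hp : 2 < p)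
    (f : ℝ → ℝ) (hf : ClassC M p μ f)
    (q : ℝ) (hq : 2 ≤ q) (hqp : ENNReal.ofReal q < p) :
    ∀ n : ℕ, 1 ≤ n →
      (∫ ω, |∑ i ∈ Finset.range n, (f (X (i + 1) ω) - ∫ y, f y ∂μ)| ^ q ∂P) ^ (1/q)
        ≤ Real.sqrt (2 * q) *
          Real.sqrt ((n : ℝ) * ((∫ x, |f x - ∫ y, f y ∂μ| ^ q ∂μ) ^ (1/q)) ^ 2
            + 4 * M ^ 2 * (((1 - ENNReal.ofReal q / p)⁻¹).toReal) ^ (2/q) *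
              ∑ k ∈ Finset.Icc 1 (n - 1), ((n : ℝ) - (k : ℝ)) *
                (2 * alpha1 (Kop K) μ k) ^
                  (2 * ((1 / ENNReal.ofReal q - 1 / p).toReal))) := by
  have hq0 : 0 < q := by linarith
  have hlaw : ∀ i, P.map (X i) = μ := fun i => by
    have h1 := congrArg (Measure.map fun z : Fin 1 → ℝ => z 0) (hstat i 1)
    rw [Measure.map_map (measurable_pi_apply _) (measurable_pi_lambda _ fun _ => hXm _),
      Measure.map_map (measurable_pi_apply _) (measurable_pi_lambda _ fun _ => hXm _)] at h1
    simpa [Function.comp_def, hX0] using h1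
  intro n _
  set f' : ℝ → ℝ := hf.1.1.mk f with hf'
  have hff' : f =ᵐ[μ] f' := hf.1.1.ae_eq_mk
  have h1 := integral_abs_sum_comp_rpow_le hXm hMarkov hinv hlaw hM hq hqp
    hf.1.1.stronglyMeasurable_mk.measurable (hf.congr hff') n
  have hm : ∫ y, f' y ∂μ = ∫ y, f y ∂μ := integral_congr_ae hff'.symm
  have hsum : ∫ ω, |∑ i ∈ Finset.range n, (f' (X (i + 1) ω) - ∫ y, f' y ∂μ)| ^ q ∂P
      = ∫ ω, |∑ i ∈ Finset.range n, (f (X (i + 1) ω) - ∫ y, f y ∂μ)| ^ q ∂P := by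
    have hae : ∀ᵐ ω ∂P, ∀ i, f (X i ω) = f' (X i ω) := ae_all_iff.2 fun i =>
      ae_of_ae_map (hXm i).aemeasurable (by rw [hlaw i]; exact hff')
    refine integral_congr_ae ?_
    filter_upwards [hae] with ω hω
    simp only [hω, hm]
  have hvar : ∫ x, |f' x - ∫ y, f' y ∂μ| ^ q ∂μ = ∫ x, |f x - ∫ y, f y ∂μ| ^ q ∂μ := by
    refine integral_congr_ae ?_
    filter_upwards [hff'] with x hx
    rw [hx, hm]
  have hsq : ∀ A : ℝ, 0 ≤ A → (A ^ (1 / q)) ^ 2 = A ^ (2 / q) := fun A hA => by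
    rw [← Real.rpow_natCast, ← Real.rpow_mul hA]
    congr 1
    push_cast
    ring
  rw [hsum, sum_range_sum_range_sub] at h1
  rw [toReal_inv_one_sub_div hq hqp, toReal_one_div_sub_one_div hq hqp,
    ← Real.sqrt_mul (by positivity)]
  refine Real.le_sqrt_of_sq_le ?_
  rw [hsq _ (integral_nonneg fun ω => Real.rpow_nonneg (abs_nonneg _) _),
    hsq _ (integral_nonneg fun x => Real.rpow_nonneg (abs_nonneg _) _), Finset.mul_sum]
  have h2 : ∀ k ∈ Finset.Icc 1 (n - 1), ((n : ℝ) - k) * lagBound K μ M p q f' k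
      = 4 * M ^ 2 * ((1 - q * (1 / p).toReal)⁻¹) ^ (2 / q) *
        (((n : ℝ) - k) * (2 * alpha1 (Kop K) μ k) ^ (2 * (1 / q - (1 / p).toReal))) := by
    intro k hk
    obtain ⟨l, rfl⟩ : ∃ l, k = l + 1 := ⟨k - 1, by have := (Finset.mem_Icc.1 hk).1; omega⟩
    simp only [lagBound, covBound]
    ring
  have h3 : 0 ≤ ∑ k ∈ Finset.Icc 1 (n - 1), ((n : ℝ) - k) * lagBound K μ M p q f' k := by
    refine Finset.sum_nonneg fun k hk => mul_nonneg ?_ (lagBound_nonneg hq hqp _ _)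
    have := (Finset.mem_Icc.1 hk).2
    exact sub_nonneg.2 (Nat.cast_le.2 (by omega))
  have h4 : 0 ≤ (n : ℝ) * lagBound K μ M p q f' 0 :=
    mul_nonneg n.cast_nonneg (lagBound_nonneg hq hqp _ _)
  have h5 : lagBound K μ M p q f' 0 = (∫ x, |f x - ∫ y, f y ∂μ| ^ q ∂μ) ^ (2 / q) := by
    rw [lagBound, hvar]
  rw [← h5, ← Finset.sum_congr rfl h2]
  exact h1.trans (mul_le_mul_of_nonneg_right (by linarith) (by linarith))

end
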